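/- arXiv:1709.03825 — 2 statements merged into one kernel-verified Lean document; each statement's English description precedes it below -/
import Mathlib

section
/- Let A be a Noetherian local ring whose completion Â is equidimensional; then A is universally catenary. Consequently, if A is a Noetherian local domain which is not universally catenary, then Â is not equidimensional. -/
open IsLocalRing

/-- A chain of primes indexed by `Fin (n+1)` is saturated if each step is a covering
relation in `Spec`. -/
def IsSaturatedChain {R : Type} [CommRing R] {n : ℕ} (f : Fin (n + 1) → PrimeSpectrum R) : Prop :=
  ∀ i : Fin n, f i.castSucc ⋖ f i.succ

/-- A ring is catenary if any two saturated chains of primes with the same endpoints have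
the same length. -/
def IsCatenary (R : Type) [CommRing R] : Prop :=
  ∀ (n m : ℕ) (f : Fin (n + 1) → PrimeSpectrum R) (g : Fin (m + 1) → PrimeSpectrum R),
    IsSaturatedChain f → IsSaturatedChain g → f 0 = g 0 →
    f (Fin.last n) = g (Fin.last m) → n = m

/-- A ring is universally catenary if every polynomial ring over it in finitely many
variables is catenary (equivalently, every finitely generated algebra over it is
catenary). -/
def IsUniversallyCatenary (R : Type) [CommRing R] : Prop :=
  ∀ n : ℕ, IsCatenary (MvPolynomial (Fin n) R)

/-- A ring is equidimensional if `dim (R/P) = dim R` for every minimal prime `P`. -/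
def IsEquidimensional (R : Type) [CommRing R] : Prop :=
  ∀ P ∈ minimalPrimes R, ringKrullDim (R ⧸ P) = ringKrullDim R

namespace PowerSeries

variable {S : Type} [CommRing S]

/-- The power series whose `j`-th coefficient lies in `I ^ (n - j)`. -/
def coeffFiltration (I : Ideal S) (n : ℕ) : AddSubgroup (PowerSeries S) where
  carrier := {f | ∀ j, coeff j f ∈ I ^ (n - j)}
  add_mem' hf hg j := by simpa using add_mem (hf j) (hg j)
  zero_mem' j := by simp
  neg_mem' hf j := by simpa using hf j

theorem mul_mem_coeffFiltration {I : Ideal S} {m n : ℕ} {f g : PowerSeries S}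
    (hf : f ∈ coeffFiltration I m) (hg : g ∈ coeffFiltration I n) :
    f * g ∈ coeffFiltration I (m + n) := by
  intro j
  rw [coeff_mul]
  refine sum_mem fun p hp ↦ ?_
  replace hp := Finset.HasAntidiagonal.mem_antidiagonal.mp hp
  have := Ideal.mul_mem_mul (hf p.1) (hg p.2)
  rw [← pow_add] at this
  exact Ideal.pow_le_pow_right (by omega) this

theorem mem_pow_iff (I : Ideal S) (n : ℕ) (f : PowerSeries S) :
    f ∈ (I.map (C (R := S)) ⊔ Ideal.span {X}) ^ n ↔ ∀ j, coeff j f ∈ I ^ (n - j) := by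
  constructor
  · let F : Ideal (PowerSeries S) :=
      { coeffFiltration I 1 with
        smul_mem' := fun c x hx ↦ by
          have := mul_mem_coeffFiltration (m := 0) (f := c) (fun j ↦ by simp) hx
          simpa using this }
    have h1 : I.map (C (R := S)) ⊔ Ideal.span {X} ≤ F := by
      refine sup_le (Ideal.map_le_iff_le_comap.mpr fun x hx j ↦ ?_) ?_
      · rw [coeff_C]
        split_ifs with h
        · subst h; simpa using hx
        · simp
      · rw [Ideal.span_le, Set.singleton_subset_iff]
        intro j
        rw [coeff_X]
        split_ifs with h
        · subst h; simp
        · simp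
    induction n generalizing f with
    | zero => intro _ j; simp
    | succ n ih =>
      intro hf
      rw [pow_succ] at hf
      refine Submodule.mul_induction_on hf (fun x hx y hy ↦ ?_) fun x y hx hy ↦
        (coeffFiltration I (n + 1)).add_mem hx hy
      exact mul_mem_coeffFiltration (ih x hx) (h1 hy)
  · intro h
    set J := I.map (C (R := S)) ⊔ Ideal.span {X}
    have hX : (X : PowerSeries S) ∈ J := Ideal.mem_sup_right (Ideal.mem_span_singleton_self _)
    have hd : (X : PowerSeries S) ^ n ∣ f - (trunc n f : Polynomial S) := by
      rw [X_pow_dvd_iff]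
      intro m hm
      simp [coeff_trunc, hm]
    have h2 : f - (trunc n f : Polynomial S) ∈ J ^ n :=
      Ideal.mem_of_dvd _ hd (Ideal.pow_mem_pow hX n)
    have h3 : ((trunc n f : Polynomial S) : PowerSeries S) ∈ J ^ n := by
      rw [(trunc n f).as_sum_range_C_mul_X_pow, ← Polynomial.coeToPowerSeries.ringHom_apply,
        map_sum]
      refine sum_mem fun j _ ↦ ?_
      simp only [Polynomial.coeToPowerSeries.ringHom_apply, Polynomial.coe_mul, Polynomial.coe_C,
        Polynomial.coe_pow, Polynomial.coe_X, coeff_trunc]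
      split_ifs with hj
      · have e : n = (n - j) + j := by omega
        have h4 : C (coeff j f) ∈ J ^ (n - j) := by
          have := Ideal.mem_map_of_mem (C (R := S)) (h j)
          rw [Ideal.map_pow] at this
          exact Ideal.pow_right_mono le_sup_left _ this
        have := Ideal.mul_mem_mul h4 (Ideal.pow_mem_pow hX j)
        rwa [← pow_add, ← e] at this
      · simp
    simpa using add_mem h2 h3

theorem isAdicComplete_map_sup_span_X (I : Ideal S) [IsAdicComplete I S] :
    IsAdicComplete (I.map (C (R := S)) ⊔ Ideal.span {X}) (PowerSeries S) where
  haus' f hf := by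
    ext j
    refine IsHausdorff.haus' (I := I) _ fun n ↦ ?_
    have := hf (n + j)
    rw [SModEq.zero] at this ⊢
    simp only [smul_eq_mul, Ideal.mul_top] at this ⊢
    simpa using (mem_pow_iff I _ f).mp this j
  prec' f hf := by
    have key (j : ℕ) : ∃ c : S, ∀ n, coeff j (f (n + j)) - c ∈ I ^ n := by
      obtain ⟨c, hc⟩ := IsPrecomplete.prec' (I := I) (fun n ↦ coeff j (f (n + j))) (by
        intro m n hmn
        have := hf (show m + j ≤ n + j by omega)
        rw [SModEq.sub_mem] at this ⊢
        simp only [smul_eq_mul, Ideal.mul_top] at this ⊢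
        simpa using (mem_pow_iff I _ _).mp this j)
      refine ⟨c, fun n ↦ ?_⟩
      have := hc n
      rw [SModEq.sub_mem] at this
      simpa using this
    choose c hc using key
    refine ⟨mk c, fun n ↦ ?_⟩
    rw [SModEq.sub_mem]
    simp only [smul_eq_mul, Ideal.mul_top]
    rw [mem_pow_iff]
    intro j
    rcases le_or_gt j n with h | h
    · have := hc j (n - j)
      rw [Nat.sub_add_cancel h] at this
      simpa using this
    · simp [show n - j = 0 by omega]

end PowerSeries

namespace PowerSeries

variable {S : Type} [CommRing S]

section Eval

variable {R : Type} [CommRing R] (J : Ideal R) (φ : S →+* R) {a : R}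

theorem eval₂_sub_mem_pow_of_X_pow_dvd (ha : a ∈ J) {n : ℕ} {p q : Polynomial S}
    (h : (Polynomial.X : Polynomial S) ^ n ∣ p - q) :
    p.eval₂ φ a - q.eval₂ φ a ∈ J ^ n := by
  obtain ⟨r, hr⟩ := h
  rw [← Polynomial.eval₂_sub, hr, Polynomial.eval₂_mul, Polynomial.eval₂_X_pow]
  exact Ideal.mul_mem_right _ _ (Ideal.pow_mem_pow ha n)

/-- Evaluation of the truncation of a power series, modulo a power of an ideal. -/
noncomputable def truncEval (ha : a ∈ J) (n : ℕ) : PowerSeries S →+* R ⧸ J ^ n where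
  toFun f := Ideal.Quotient.mk _ ((trunc n f).eval₂ φ a)
  map_zero' := by simp
  map_one' := by
    cases n with
    | zero => exact Subsingleton.elim (h := by simp) _ _
    | succ n => simp
  map_add' f g := by simp [Polynomial.eval₂_add]
  map_mul' f g := by
    rw [← map_mul, ← Polynomial.eval₂_mul, Ideal.Quotient.eq]
    refine eval₂_sub_mem_pow_of_X_pow_dvd J φ ha ?_
    rw [Polynomial.X_pow_dvd_iff]
    intro d hd
    rw [Polynomial.coeff_sub, coeff_trunc, if_pos hd, coeff_mul, Polynomial.coeff_mul, sub_eq_zero]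
    refine Finset.sum_congr rfl fun p hp ↦ ?_
    replace hp := Finset.HasAntidiagonal.mem_antidiagonal.mp hp
    rw [coeff_trunc, coeff_trunc, if_pos (by omega), if_pos (by omega)]

theorem exists_ringHom_eval [IsAdicComplete J R] (ha : a ∈ J) :
    ∃ Φ : PowerSeries S →+* R, Φ.comp C = φ ∧ Φ X = a := by
  have hc {m n : ℕ} (hle : m ≤ n) : (Ideal.Quotient.factorPow J hle).comp (truncEval J φ ha n) =
      truncEval J φ ha m := by
    ext f
    change Ideal.Quotient.factorPow J hle (Ideal.Quotient.mk _ _) = Ideal.Quotient.mk _ _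
    rw [Ideal.Quotient.factorPow, Ideal.Quotient.factor_mk, Ideal.Quotient.eq]
    refine eval₂_sub_mem_pow_of_X_pow_dvd J φ ha ?_
    rw [Polynomial.X_pow_dvd_iff]
    intro d hd
    simp [coeff_trunc, hd, hd.trans_le hle]
  refine ⟨IsAdicComplete.liftRingHom J (truncEval J φ ha) hc, ?_, ?_⟩
  · ext s
    refine (IsHausdorff.eq_iff_smodEq (I := J)).mpr fun n ↦ ?_
    rw [SModEq.sub_mem]
    simp only [smul_eq_mul, Ideal.mul_top]
    rw [← Ideal.Quotient.eq, RingHom.comp_apply, IsAdicComplete.mk_liftRingHom]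
    cases n with
    | zero => exact Subsingleton.elim (h := by simp) _ _
    | succ n => simp [truncEval]
  · refine (IsHausdorff.eq_iff_smodEq (I := J)).mpr fun n ↦ ?_
    rw [SModEq.sub_mem]
    simp only [smul_eq_mul, Ideal.mul_top]
    rw [← Ideal.Quotient.eq, IsAdicComplete.mk_liftRingHom]
    rcases n with _ | _ | n
    · exact Subsingleton.elim (h := by simp) _ _
    · have : truncEval J φ ha (0 + 1) X = 0 := by simp [truncEval]
      rw [this, eq_comm, Ideal.Quotient.eq_zero_iff_mem]
      simpa using ha
    · simp [truncEval, trunc_X]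

end Eval

theorem X_mem_jacobson : (X : PowerSeries S) ∈ Ring.jacobson (PowerSeries S) := by
  rw [← Ideal.jacobson_bot, Ideal.mem_jacobson_bot]
  intro y
  rw [isUnit_iff_constantCoeff]
  simp

theorem ker_constantCoeff : RingHom.ker (constantCoeff (R := S)) = Ideal.span {X} := by
  ext f
  rw [RingHom.mem_ker, Ideal.mem_span_singleton, X_dvd_iff]

theorem ringKrullDim_eq_add_one [IsNoetherianRing S] :
    ringKrullDim (PowerSeries S) = ringKrullDim S + 1 := by
  rw [← ringKrullDim_quotient_span_singleton_succ_eq_ringKrullDim_of_mem_jacobson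
    (x := (X : PowerSeries S)) _ X_mem_jacobson]
  · rw [ringKrullDim_eq_of_ringEquiv ((Ideal.quotEquivOfEq ker_constantCoeff.symm).trans
      (RingHom.quotientKerEquivOfSurjective (f := constantCoeff (R := S)) constantCoeff_surj))]
  · intro f g h
    exact X_mul_cancel h

theorem exists_iterated {Λ R : Type} [CommRing Λ] [CommRing R] [IsNoetherianRing Λ]
    (J : Ideal R) [IsAdicComplete J R] (I₀ : Ideal Λ) [IsAdicComplete I₀ Λ] (f : Λ →+* R)
    (l : List R) (hl : ∀ a ∈ l, a ∈ J) :
    ∃ (S : Type) (_ : CommRing S) (_ : IsNoetherianRing S) (I : Ideal S) (_ : IsAdicComplete I S)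
      (g : Λ →+* S) (φ : S →+* R), φ.comp g = f ∧
      I.map φ = I₀.map f ⊔ Ideal.span {a | a ∈ l} ∧
      (IsDomain Λ → IsDomain S) ∧ ringKrullDim S = ringKrullDim Λ + l.length ∧
      {a | a ∈ l} ⊆ Set.range φ := by
  induction l with
  | nil =>
    exact ⟨Λ, inferInstance, inferInstance, I₀, inferInstance, RingHom.id _, f, by simp, by simp,
      id, by simp, by simp⟩
  | cons a l ih =>
    obtain ⟨S, _, _, I, _, g, φ, h1, h2, h3, h4, h5⟩ := ih fun b hb ↦ hl b (by simp [hb])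
    obtain ⟨Φ, h6, h7⟩ := exists_ringHom_eval J φ (hl a (by simp))
    refine ⟨PowerSeries S, inferInstance, inferInstance, _, isAdicComplete_map_sup_span_X I,
      C.comp g, Φ, ?_, ?_, fun h ↦ ?_, ?_, ?_⟩
    · rw [← RingHom.comp_assoc, h6, h1]
    · rw [Ideal.map_sup, Ideal.map_map, h6, h2, Ideal.map_span, Set.image_singleton, h7, sup_assoc,
        ← Ideal.span_union]
      congr 2
      ext b
      simp
    · have := h3 h
      infer_instance
    · rw [ringKrullDim_eq_add_one, h4]
      simp [add_assoc]
    · rintro b hb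
      rcases List.mem_cons.mp hb with rfl | hb
      · exact ⟨X, h7⟩
      · obtain ⟨s, hs⟩ := h5 hb
        exact ⟨C s, by rw [← hs, ← h6]; rfl⟩

end PowerSeries

theorem IsPrecomplete.pi_fin {S : Type} [CommRing S] (I : Ideal S) [IsPrecomplete I S]
    (r : ℕ) : IsPrecomplete I (Fin r → S) where
  prec' f hf := by
    have mem_iff (n : ℕ) (x : Fin r → S) :
        x ∈ (I ^ n • ⊤ : Submodule S (Fin r → S)) ↔ ∀ i, x i ∈ I ^ n := by
      constructor
      · intro hx i
        refine Submodule.smul_induction_on hx (fun r hr y _ ↦ ?_) fun y z hy hz ↦ add_mem hy hz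
        exact Ideal.mul_mem_right _ _ hr
      · intro hx
        rw [pi_eq_sum_univ x]
        exact sum_mem fun i _ ↦ Submodule.smul_mem_smul (hx i) trivial
    have key (i : Fin r) : ∃ c : S, ∀ n, f n i - c ∈ I ^ n := by
      obtain ⟨c, hc⟩ := IsPrecomplete.prec' (I := I) (fun n ↦ f n i) (by
        intro m n hmn
        have := hf hmn
        rw [SModEq.sub_mem] at this ⊢
        simpa using (mem_iff _ _).mp this i)
      refine ⟨c, fun n ↦ ?_⟩
      have := hc n
      rw [SModEq.sub_mem] at this
      simpa using this
    choose c hc using key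
    refine ⟨c, fun n ↦ ?_⟩
    rw [SModEq.sub_mem, mem_iff]
    exact fun i ↦ hc i n

theorem Module.finite_of_isPrecomplete {S R : Type} [CommRing S] [AddCommGroup R] [Module S R]
    (I : Ideal S) [IsPrecomplete I S] [IsHausdorff I R]
    [Module.Finite S (R ⧸ (I • ⊤ : Submodule S R))] : Module.Finite S R := by
  obtain ⟨r, f, hf⟩ := Module.Finite.exists_fin' S (R ⧸ (I • ⊤ : Submodule S R))
  obtain ⟨g, hg⟩ := Module.projective_lifting_property (Submodule.mkQ (I • ⊤ : Submodule S R)) f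
    (Submodule.mkQ_surjective _)
  have := IsPrecomplete.pi_fin I r
  exact Module.Finite.of_surjective g (surjective_of_mkQ_comp_surjective (I := I) (by
    rw [← hg] at hf; exact hf))

theorem RingHom.finite_of_isAdicComplete {S R : Type} [CommRing S] [CommRing R] (φ : S →+* R)
    (I : Ideal S) [IsPrecomplete I S] (J : Ideal R) [IsHausdorff J R] (hIJ : I.map φ ≤ J)
    (h : ((Ideal.Quotient.mk (I.map φ)).comp φ).Finite) : φ.Finite := by
  algebraize [φ, (Ideal.Quotient.mk (I.map φ)).comp φ]
  change Module.Finite S (R ⧸ I.map φ) at h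
  have : IsHausdorff (I.map φ) R := ⟨fun x hx ↦ IsHausdorff.haus' (I := J) x fun n ↦ by
    have := hx n
    rw [SModEq.zero] at this ⊢
    simp only [smul_eq_mul, Ideal.mul_top] at this ⊢
    exact Ideal.pow_right_mono hIJ n this⟩
  have : IsHausdorff I R := IsHausdorff.map_algebraMap_iff.mp this
  have e : (I • ⊤ : Submodule S R) = (I.map φ).restrictScalars S := by
    rw [Ideal.smul_top_eq_map]; rfl
  have : Module.Finite S (R ⧸ (I • ⊤ : Submodule S R)) := by
    rw [e]
    exact h
  exact Module.finite_of_isPrecomplete I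

instance AdicCompletion.isNoetherianRing_maximalIdeal {A : Type} [CommRing A] [IsLocalRing A]
    [IsNoetherianRing A] : IsNoetherianRing (AdicCompletion (maximalIdeal A) A) := by
  set R := AdicCompletion (maximalIdeal A) A
  obtain ⟨s, hs⟩ := (isNoetherianRing_iff_ideal_fg A).mp inferInstance (maximalIdeal A)
  have hm : (maximalIdeal A).map (algebraMap A R) = maximalIdeal R :=
    (AdicCompletion.maximalIdeal_eq_map (R := A)).symm
  obtain ⟨S, _, _, I, _, g, φ, h1, h2, -, -, -⟩ := PowerSeries.exists_iterated (maximalIdeal R)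
    (⊥ : Ideal A) (algebraMap A R) (s.toList.map (algebraMap A R)) (by
      intro a ha
      obtain ⟨b, hb, rfl⟩ := List.mem_map.mp ha
      rw [← hm]
      refine Ideal.mem_map_of_mem _ (hs ▸ Ideal.subset_span ?_)
      simpa using hb)
  have h3 : I.map φ = maximalIdeal R := by
    rw [h2, Ideal.map_bot, bot_sup_eq, ← hm]
    refine Eq.trans ?_ (congrArg (Ideal.map (algebraMap A R)) hs)
    rw [Ideal.map_span]
    congr 1
    ext x
    simp
  have : IsHausdorff (I.map φ) R := by rw [h3]; infer_instance
  refine isNoetherianRing_of_surjective S R φ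
    (surjective_of_mk_map_comp_surjective (I := I) φ ?_)
  intro y
  obtain ⟨x, rfl⟩ := Ideal.Quotient.mk_surjective y
  obtain ⟨a, ha⟩ := (AdicCompletion.residueField_map_bijective (R := A)).2 (residue R x)
  obtain ⟨a, rfl⟩ := residue_surjective a
  refine ⟨g a, ?_⟩
  rw [RingHom.comp_apply, ← RingHom.comp_apply φ, h1, Ideal.Quotient.eq, h3]
  rw [ResidueField.map_residue] at ha
  exact Ideal.Quotient.eq.mp ha

namespace PowerSeries

variable {R : Type} [CommRing R]

theorem mem_map_C_of_coeff_mem {I : Ideal R} (hI : I.FG) {f : PowerSeries R}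
    (hf : ∀ n, coeff n f ∈ I) : f ∈ I.map (C (R := R)) := by
  obtain ⟨r, g, hg⟩ := Submodule.fg_iff_exists_fin_generating_family.mp hI
  have (n : ℕ) : ∃ c : Fin r → R, ∑ i, c i * g i = coeff n f :=
    Ideal.mem_span_range_iff_exists_fun.mp (by
      have := hf n
      rwa [← hg] at this)
  choose c hc using this
  have : f = ∑ i, mk (fun n ↦ c n i) * C (g i) := by
    ext n
    simp [← hc n]
  rw [this]
  exact sum_mem fun i _ ↦ Ideal.mul_mem_left _ _ (Ideal.mem_map_of_mem _
    (hg ▸ Submodule.subset_span ⟨i, rfl⟩))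

theorem maximalIdeal_eq [IsLocalRing R] :
    maximalIdeal (PowerSeries R) = (maximalIdeal R).map (C (R := R)) ⊔ Ideal.span {X} := by
  ext f
  have := mem_pow_iff (maximalIdeal R) 1 f
  rw [pow_one] at this
  rw [this, mem_maximalIdeal, mem_nonunits_iff, isUnit_iff_constantCoeff]
  constructor
  · rintro h (_ | j)
    · simpa using h
    · simp
  · intro h
    simpa using h 0

end PowerSeries

/-- A complete Noetherian local ring that is equidimensional. -/
structure IsCompleteEquidimensional (R : Type) [CommRing R] [IsLocalRing R] : Prop where
  isNoetherianRing : IsNoetherianRing R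
  isAdicComplete : IsAdicComplete (maximalIdeal R) R
  isEquidimensional : IsEquidimensional R

theorem IsCompleteEquidimensional.powerSeries {R : Type} [CommRing R] [IsLocalRing R]
    (h : IsCompleteEquidimensional R) : IsCompleteEquidimensional (PowerSeries R) := by
  obtain ⟨h1, h2, h3⟩ := h
  refine ⟨inferInstance, ?_, fun P hP ↦ ?_⟩
  · rw [PowerSeries.maximalIdeal_eq]
    exact PowerSeries.isAdicComplete_map_sup_span_X _
  have hP' : P.IsPrime := Ideal.IsMinimalPrime.isPrime hP
  obtain ⟨q, hq, hqP⟩ := Ideal.exists_minimalPrimes_le (I := (⊥ : Ideal R))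
    (J := P.comap (PowerSeries.C (R := R))) bot_le
  have hq' : q.IsPrime := Ideal.IsMinimalPrime.isPrime hq
  have hk : RingHom.ker (PowerSeries.map (Ideal.Quotient.mk q)) = P := by
    refine le_antisymm ?_ (hP.2 ⟨RingHom.ker_isPrime _, bot_le⟩ ?_)
    all_goals
      have : RingHom.ker (PowerSeries.map (Ideal.Quotient.mk q)) ≤ P := by
        intro f hf
        refine (Ideal.map_le_iff_le_comap.mpr hqP) (PowerSeries.mem_map_C_of_coeff_mem
          ((isNoetherianRing_iff_ideal_fg R).mp h1 q) fun n ↦ ?_)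
        rw [RingHom.mem_ker] at hf
        have := congr(PowerSeries.coeff n $hf)
        simpa [Ideal.Quotient.eq_zero_iff_mem] using this
      exact this
  rw [PowerSeries.ringKrullDim_eq_add_one, ← h3 q hq, ← PowerSeries.ringKrullDim_eq_add_one, ← hk]
  exact ringKrullDim_eq_of_ringEquiv (RingHom.quotientKerEquivOfSurjective
    (PowerSeries.map_surjective _ Ideal.Quotient.mk_surjective))

section Limit

variable {D : Type} [CommRing D]

theorem exists_limit_of_sub_mem_pow (J : Ideal D) [IsAdicComplete J D] (f : ℕ → D)
    (hf : ∀ n, f (n + 1) - f n ∈ J ^ n) : ∃ L, ∀ n, f n - L ∈ J ^ n := by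
  have h2 : ∀ m d, f m - f (m + d) ∈ J ^ m := by
    intro m d
    induction d with
    | zero => simp
    | succ d ih =>
      have := sub_mem ih (Ideal.pow_le_pow_right (Nat.le_add_right m d) (hf (m + d)))
      simpa [add_assoc] using this
  obtain ⟨L, hL⟩ := IsPrecomplete.prec' (I := J) f (by
    intro m n hmn
    rw [SModEq.sub_mem]
    simp only [smul_eq_mul, Ideal.mul_top]
    obtain ⟨d, rfl⟩ := Nat.exists_eq_add_of_le hmn
    exact h2 m d)
  refine ⟨L, fun n ↦ ?_⟩
  have := hL n
  rw [SModEq.sub_mem] at this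
  simpa using this

theorem eq_zero_of_forall_mem_pow (J : Ideal D) [IsHausdorff J D] {x : D}
    (h : ∀ n, x ∈ J ^ n) : x = 0 :=
  IsHausdorff.haus' (I := J) x fun n ↦ by
    rw [SModEq.zero]
    simpa using h n

theorem exists_mem_pow_sub_of_mul_mem_pow [IsNoetherianRing D] [IsDomain D] (J : Ideal D) {c : D}
    (hc : c ≠ 0) : ∃ k, ∀ n x, c * x ∈ J ^ (n + k) → x ∈ J ^ n := by
  obtain ⟨k, hk⟩ := Ideal.exists_pow_inf_eq_pow_smul J (Ideal.span {c} : Submodule D D)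
  refine ⟨k, fun n x hx ↦ ?_⟩
  have h1 : c * x ∈ J ^ n • (J ^ k • (⊤ : Submodule D D) ⊓ Ideal.span {c}) := by
    have := hk (n + k) (by omega)
    rw [Nat.add_sub_cancel] at this
    rw [← this]
    exact ⟨by simpa using hx, Ideal.mul_mem_right _ _ (Ideal.mem_span_singleton_self c)⟩
  have h2 : c * x ∈ J ^ n * Ideal.span {c} :=
    Submodule.smul_mono le_rfl inf_le_right h1
  obtain ⟨z, hz, hzx⟩ := Ideal.mem_mul_span_singleton.mp h2
  have : z = x := mul_left_cancel₀ hc (by rw [mul_comm, hzx])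
  rwa [← this]

/-- A subring closed for the adic topology. -/
def IsAdicClosed (J : Ideal D) (Λ : Subring D) : Prop :=
  ∀ x, (∀ n, ∃ l ∈ Λ, x - l ∈ J ^ n) → x ∈ Λ

theorem IsAdicClosed.exists_eq_mul [IsNoetherianRing D] [IsDomain D] {J : Ideal D}
    [IsAdicComplete J D] {Λ : Subring D} (hΛ : IsAdicClosed J Λ) {a c : D}
    (h : ∀ n, ∃ l ∈ Λ, a - c * l ∈ J ^ n) : ∃ l ∈ Λ, a = c * l := by
  rcases eq_or_ne c 0 with rfl | hc
  · refine ⟨0, Λ.zero_mem, ?_⟩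
    rw [mul_zero]
    exact eq_zero_of_forall_mem_pow J fun n ↦ by
      obtain ⟨l, -, hl⟩ := h n
      simpa using hl
  obtain ⟨k, hk⟩ := exists_mem_pow_sub_of_mul_mem_pow J hc
  choose f hf hf' using fun n ↦ h (n + k)
  obtain ⟨L, hL⟩ := exists_limit_of_sub_mem_pow J f fun n ↦ hk n _ (by
    have := sub_mem (hf' n) (Ideal.pow_le_pow_right (by omega) (hf' (n + 1)))
    convert! this using 1
    ring)
  refine ⟨L, hΛ L fun n ↦ ⟨f n, hf n, by rw [← neg_mem_iff]; simpa using hL n⟩, ?_⟩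
  rw [← sub_eq_zero]
  refine eq_zero_of_forall_mem_pow J fun n ↦ ?_
  have := add_mem (Ideal.pow_le_pow_right (by omega) (hf' n)) (Ideal.mul_mem_left _ c (hL n))
  convert! this using 1
  ring

theorem IsAdicClosed.isAdicComplete_span [IsNoetherianRing D] [IsDomain D] {J : Ideal D}
    [IsAdicComplete J D] {Λ : Subring D} (hΛ : IsAdicClosed J Λ) {p : Λ} (hp : (p : D) ∈ J) :
    IsAdicComplete (Ideal.span {p}) Λ := by
  have key {n : ℕ} {x : Λ} (hx : x ∈ Ideal.span {p} ^ n) : (x : D) ∈ J ^ n := by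
    rw [Ideal.span_singleton_pow, Ideal.mem_span_singleton] at hx
    obtain ⟨y, rfl⟩ := hx
    simpa using Ideal.mul_mem_right _ _ (Ideal.pow_mem_pow hp n)
  refine { haus' := fun x hx ↦ ?_, prec' := fun f hf ↦ ?_ }
  · refine Subtype.ext (eq_zero_of_forall_mem_pow J fun n ↦ key ?_)
    have := hx n
    rw [SModEq.zero] at this
    simpa using this
  · have hf2 {m n : ℕ} (h : m ≤ n) : f m - f n ∈ Ideal.span {p} ^ m := by
      have := hf h
      rw [SModEq.sub_mem] at this
      simpa using this
    obtain ⟨L, hL⟩ := exists_limit_of_sub_mem_pow J (fun n ↦ (f n : D)) fun n ↦ by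
      rw [← neg_mem_iff]
      simpa using key (hf2 n.le_succ)
    have hLΛ : L ∈ Λ := hΛ L fun n ↦ ⟨f n, (f n).2, by rw [← neg_mem_iff]; simpa using hL n⟩
    refine ⟨⟨L, hLΛ⟩, fun n ↦ ?_⟩
    rw [SModEq.sub_mem]
    simp only [smul_eq_mul, Ideal.mul_top]
    rw [Ideal.span_singleton_pow, Ideal.mem_span_singleton]
    obtain ⟨l, hl, hl'⟩ := hΛ.exists_eq_mul (a := f n - L) (c := (p : D) ^ n) fun N ↦ by
      have h1 := hf2 (Nat.le_add_right n N)
      rw [Ideal.span_singleton_pow, Ideal.mem_span_singleton] at h1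
      obtain ⟨y, hy⟩ := h1
      refine ⟨y, y.2, ?_⟩
      have h2 : (f n - L : D) - p ^ n * y = f (n + N) - L := by
        have := congr((($hy : Λ) : D))
        push_cast at this
        rw [← this]
        ring
      rw [h2]
      exact Ideal.pow_le_pow_right (by omega) (hL (n + N))
    exact ⟨⟨l, hl⟩, Subtype.ext hl'⟩

/-- A coefficient ring: a subring `Λ` mapping onto the residue field and complete with respect to
an element `p` generating `Λ ∩ 𝔪`. -/
structure IsCoefficientRing [IsLocalRing D] (Λ : Subring D) (p : Λ) : Prop where
  exists_sub_mem : ∀ d, ∃ l ∈ Λ, d - l ∈ maximalIdeal D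
  dvd_of_mem : ∀ l : Λ, (l : D) ∈ maximalIdeal D → p ∣ l
  mem : (p : D) ∈ maximalIdeal D
  isAdicComplete : IsAdicComplete (Ideal.span {p}) Λ

theorem exists_isCoefficientRing_of_antitone [IsLocalRing D] [IsNoetherianRing D] [IsDomain D]
    [IsAdicComplete (maximalIdeal D) D] (p : ℕ) (hp : (p : D) ∈ maximalIdeal D)
    (G : ℕ → Subring D) (hG : Antitone G)
    (h1 : ∀ n d, ∃ l ∈ G n, d - l ∈ maximalIdeal D)
    (h2 : ∀ n, ∀ x ∈ G (n + 1), x ∈ maximalIdeal D →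
      ∃ v ∈ G n, x - p * v ∈ maximalIdeal D ^ (n + 2)) :
    ∃ (Λ : Subring D) (π : Λ), IsCoefficientRing Λ π := by
  set m := maximalIdeal D
  have h3 (j : ℕ) : ∀ n, j ≤ n → ∀ x ∈ G j, ∃ y ∈ G n, x - y ∈ m ^ (j + 1) := by
    induction j with
    | zero =>
      intro n _ x hx
      obtain ⟨l, hl, h⟩ := h1 n x
      exact ⟨l, hl, by simpa using h⟩
    | succ j ih =>
      intro n hn x hx
      obtain ⟨y, hy, hxy⟩ := h1 n x
      obtain ⟨v, hv, hv'⟩ := h2 j (x - y) (sub_mem hx (hG hn hy)) hxy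
      obtain ⟨w, hw, hw'⟩ := ih n (by omega) v hv
      refine ⟨y + p * w, add_mem hy (mul_mem (natCast_mem _ p) hw), ?_⟩
      have h4 := Ideal.mul_mem_mul hp hw'
      rw [← pow_succ'] at h4
      have := add_mem hv' h4
      convert! this using 1
      ring
  let Λ : Subring D :=
    { carrier := {x | ∀ j, ∃ y ∈ G j, x - y ∈ m ^ (j + 1)}
      mul_mem' := fun {a b} ha hb j ↦ by
        obtain ⟨y, hy, hay⟩ := ha j
        obtain ⟨z, hz, hbz⟩ := hb j
        refine ⟨y * z, mul_mem hy hz, ?_⟩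
        have := add_mem (Ideal.mul_mem_left _ a hbz) (Ideal.mul_mem_left _ z hay)
        convert! this using 1
        ring
      one_mem' := fun j ↦ ⟨1, one_mem _, by simp⟩
      add_mem' := fun {a b} ha hb j ↦ by
        obtain ⟨y, hy, hay⟩ := ha j
        obtain ⟨z, hz, hbz⟩ := hb j
        refine ⟨y + z, add_mem hy hz, ?_⟩
        have := add_mem hay hbz
        convert! this using 1
        ring
      zero_mem' := fun j ↦ ⟨0, zero_mem _, by simp⟩
      neg_mem' := fun {a} ha j ↦ by
        obtain ⟨y, hy, hay⟩ := ha j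
        refine ⟨-y, neg_mem hy, ?_⟩
        have := neg_mem hay
        convert! this using 1
        ring }
  have hΛ : IsAdicClosed m Λ := fun x hx j ↦ by
    obtain ⟨l, hl, hxl⟩ := hx (j + 1)
    obtain ⟨y, hy, hly⟩ := hl j
    exact ⟨y, hy, by simpa using add_mem hxl hly⟩
  have h4 (j : ℕ) (x : D) (hx : x ∈ G j) : ∃ l ∈ Λ, x - l ∈ m ^ (j + 1) := by
    choose! g hg hg' using fun i ↦ h3 i (i + 1) (by omega)
    let f : ℕ → D := fun i ↦ Nat.rec x (fun i y ↦ g (j + i) y) i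
    have hf (i : ℕ) : f i ∈ G (j + i) := by
      induction i with
      | zero => exact hx
      | succ i ih => exact hg _ _ ih
    have hf' (i : ℕ) : f (i + 1) - f i ∈ m ^ (j + i + 1) := by
      rw [← neg_mem_iff, neg_sub]
      exact hg' _ _ (hf i)
    obtain ⟨L, hL⟩ := exists_limit_of_sub_mem_pow m f fun n ↦
      Ideal.pow_le_pow_right (by omega) (hf' n)
    have hL' (i : ℕ) : f i - L ∈ m ^ (j + i + 1) := by
      have h5 (e : ℕ) : f (i + e) - f i ∈ m ^ (j + i + 1) := by
        induction e with
        | zero => simp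
        | succ e ih =>
          have := add_mem ih (Ideal.pow_le_pow_right (by omega) (hf' (i + e)))
          convert! this using 1
          rw [← add_assoc]
          ring
      have := sub_mem (Ideal.pow_le_pow_right (by omega) (hL (i + (j + i + 1)))) (h5 (j + i + 1))
      convert! this using 1
      ring
    refine ⟨L, fun i ↦ ⟨f i, hG (by omega) (hf i), ?_⟩, hL' 0⟩
    rw [← neg_mem_iff, neg_sub]
    exact Ideal.pow_le_pow_right (by omega) (hL' i)
  have hpΛ : (p : D) ∈ Λ := natCast_mem _ p
  refine ⟨Λ, ⟨p, hpΛ⟩, fun d ↦ ?_, fun l hl ↦ ?_, hp, hΛ.isAdicComplete_span hp⟩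
  · obtain ⟨x, hx, hdx⟩ := h1 0 d
    obtain ⟨l, hl, hxl⟩ := h4 0 x hx
    refine ⟨l, hl, ?_⟩
    rw [zero_add, pow_one] at hxl
    have := add_mem hdx hxl
    rwa [sub_add_sub_cancel] at this
  · obtain ⟨y, hy, h⟩ := hΛ.exists_eq_mul (a := (l : D)) (c := (p : D)) fun n ↦ by
      obtain ⟨y, hy, hly⟩ := l.2 (n + 1)
      have hym : y ∈ m := by
        have := sub_mem hl (Ideal.pow_le_self (by omega) hly)
        rwa [sub_sub_cancel] at this
      obtain ⟨v, hv, hv'⟩ := h2 n y hy hym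
      obtain ⟨μ, hμ, hvμ⟩ := h4 n v hv
      refine ⟨μ, hμ, Ideal.pow_le_pow_right (show n ≤ n + 2 by omega) ?_⟩
      have h4 := Ideal.mul_mem_mul hp hvμ
      rw [← pow_succ'] at h4
      have := add_mem (add_mem hly hv') h4
      convert! this using 1
      ring
    exact ⟨⟨y, hy⟩, Subtype.ext h⟩

end Limit

section Monomials

variable {ι M : Type} [CommMonoid M]

/-- The monomial with exponent `e` in a family of elements of a commutative monoid. -/
def monomialEval (B : ι → M) (e : ι →₀ ℕ) : M := e.prod fun i n ↦ B i ^ n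

@[simp]
theorem monomialEval_zero (B : ι → M) : monomialEval B 0 = 1 := by simp [monomialEval]

theorem monomialEval_add (B : ι → M) (e f : ι →₀ ℕ) :
    monomialEval B (e + f) = monomialEval B e * monomialEval B f := by
  classical
  exact Finsupp.prod_add_index' (by simp) (by simp [pow_add])

theorem monomialEval_nsmul (B : ι → M) (n : ℕ) (e : ι →₀ ℕ) :
    monomialEval B (n • e) = monomialEval B e ^ n := by
  induction n with
  | zero => simp
  | succ n ih => rw [succ_nsmul, monomialEval_add, ih, pow_succ]

@[simp]
theorem monomialEval_single (B : ι → M) (i : ι) (n : ℕ) :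
    monomialEval B (Finsupp.single i n) = B i ^ n := by
  simp [monomialEval]

theorem map_monomialEval {N : Type} [CommMonoid N] (f : M →* N) (B : ι → M) (e : ι →₀ ℕ) :
    f (monomialEval B e) = monomialEval (fun i ↦ f (B i)) e := by
  simp [monomialEval, Finsupp.prod]

theorem monomialEval_mem {C : Type} [SetLike C M] [SubmonoidClass C M] {H : C} {B : ι → M}
    {s : Set ι} (hB : ∀ i ∈ s, B i ∈ H) {e : ι →₀ ℕ} (he : (e.support : Set ι) ⊆ s) :
    monomialEval B e ∈ H :=
  prod_mem fun i hi ↦ pow_mem (hB i (he hi)) _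

theorem exists_eq_monomialEval_of_mem_closure {B : ι → M} {s : Set ι} {x : M}
    (hx : x ∈ Submonoid.closure (B '' s)) :
    ∃ f : ι →₀ ℕ, (f.support : Set ι) ⊆ s ∧ x = monomialEval B f := by
  classical
  induction hx using Submonoid.closure_induction with
  | mem x hx =>
    obtain ⟨i, hi, rfl⟩ := hx
    exact ⟨Finsupp.single i 1, by
      intro j hj
      have := Finsupp.support_single_subset hj
      simp at this
      exact this ▸ hi, by simp⟩
  | one => exact ⟨0, by simp, by simp⟩
  | mul x y _ _ hx hy =>
    obtain ⟨f, hf, rfl⟩ := hx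
    obtain ⟨g, hg, rfl⟩ := hy
    refine ⟨f + g, fun i hi ↦ ?_, (monomialEval_add B f g).symm⟩
    rcases Finset.mem_union.mp (Finsupp.support_add hi) with h | h
    exacts [hf h, hg h]

end Monomials

/-- Exponents supported in `s` with all entries less than `p`. -/
def reducedExponents {ι : Type} (p : ℕ) (s : Set ι) : Set (ι →₀ ℕ) :=
  {e | (∀ i, e i < p) ∧ (e.support : Set ι) ⊆ s}

theorem exists_reducedExponents_add_nsmul {ι : Type} {p : ℕ} (hp : 0 < p) {s : Set ι}
    {f : ι →₀ ℕ} (hf : (f.support : Set ι) ⊆ s) :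
    ∃ e ∈ reducedExponents p s, ∃ g : ι →₀ ℕ, (g.support : Set ι) ⊆ s ∧ f = e + p • g := by
  refine ⟨f.mapRange (· % p) (Nat.zero_mod p), ⟨fun i ↦ Nat.mod_lt _ hp, ?_⟩,
    f.mapRange (· / p) (Nat.zero_div p), ?_, ?_⟩
  · exact subset_trans (Finset.coe_subset.mpr Finsupp.support_mapRange) hf
  · exact subset_trans (Finset.coe_subset.mpr Finsupp.support_mapRange) hf
  · ext i
    exact (Nat.mod_add_div (f i) p).symm

section PBasis

variable (k : Type) [Field k] (p : ℕ) [Fact p.Prime] [CharP k p]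

theorem exists_pBasis : ∃ s : Set k,
    LinearIndepOn (frobenius k p).fieldRange (monomialEval (id : k → k)) (reducedExponents p s) ∧
    Submodule.span (frobenius k p).fieldRange
      (monomialEval (id : k → k) '' reducedExponents p s) = ⊤ := by
  classical
  have hp : p.Prime := Fact.out
  set K := (frobenius k p).fieldRange
  obtain ⟨s, hs⟩ : ∃ s : Set k, Maximal (fun s ↦ LinearIndepOn K (monomialEval (id : k → k))
      (reducedExponents p s)) s := by
    refine zorn_subset {s | LinearIndepOn K (monomialEval (id : k → k)) (reducedExponents p s)}
      fun c hc hchain ↦ ?_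
    rcases c.eq_empty_or_nonempty with rfl | hne
    · refine ⟨∅, ?_, by simp⟩
      have : reducedExponents p (∅ : Set k) ⊆ {0} := by
        rintro e ⟨-, he⟩
        simpa using he
      refine LinearIndepOn.mono ?_ this
      rw [linearIndepOn_singleton_iff]
      simp
    · refine ⟨⋃₀ c, ?_, fun s hs ↦ Set.subset_sUnion_of_mem hs⟩
      have hU : reducedExponents p (⋃₀ c) ⊆ ⋃ t : c, reducedExponents p (t : Set k) := by
        rintro e ⟨h1, h2⟩
        obtain ⟨t, ht, h3⟩ := hchain.directedOn.exists_mem_subset_of_finset_subset_biUnion hne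
          (f := id) (s := e.support) (by simpa [Set.sUnion_eq_biUnion] using h2)
        exact Set.mem_iUnion.mpr ⟨⟨t, ht⟩, h1, h3⟩
      refine LinearIndepOn.mono (linearIndepOn_iUnion_of_directed ?_ fun t ↦ hc t.2) hU
      rintro ⟨a, ha⟩ ⟨b, hb⟩
      rcases hchain.total ha hb with h | h
      · exact ⟨⟨b, hb⟩, fun e he ↦ ⟨he.1, he.2.trans h⟩, fun e he ↦ he⟩
      · exact ⟨⟨a, ha⟩, fun e he ↦ he, fun e he ↦ ⟨he.1, he.2.trans h⟩⟩
  refine ⟨s, hs.prop, ?_⟩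
  have hpow (x : k) : x ^ p ∈ K := ⟨x, rfl⟩
  have hint : Algebra.IsIntegral K k := ⟨fun x ↦ ⟨Polynomial.X ^ p - Polynomial.C ⟨x ^ p, hpow x⟩,
    Polynomial.monic_X_pow_sub_C _ hp.ne_zero, by
      simp only [Polynomial.eval₂_sub, Polynomial.eval₂_X_pow, Polynomial.eval₂_C]
      exact sub_self _⟩⟩
  have hspan : (Algebra.adjoin K s).toSubmodule ≤
      Submodule.span K (monomialEval (id : k → k) '' reducedExponents p s) := by
    rw [Algebra.adjoin_eq_span, Submodule.span_le]
    intro x hx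
    rw [← Set.image_id s] at hx
    obtain ⟨f, hf, rfl⟩ := exists_eq_monomialEval_of_mem_closure hx
    obtain ⟨e, he, g, hg, rfl⟩ := exists_reducedExponents_add_nsmul hp.pos hf
    rw [monomialEval_add, monomialEval_nsmul, mul_comm]
    exact Submodule.smul_mem _ (⟨_, hpow _⟩ : K) (Submodule.subset_span ⟨e, he, rfl⟩)
  suffices h : IntermediateField.adjoin K s = ⊤ by
    have h2 : Algebra.adjoin K s = ⊤ := by
      rw [← IntermediateField.adjoin_toSubalgebra_of_isAlgebraic
        (fun x _ ↦ (Algebra.IsAlgebraic.isAlgebraic x)), h]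
      rfl
    rw [h2] at hspan
    exact top_le_iff.mp (le_trans (by simp) hspan)
  rw [eq_top_iff]
  intro α _
  by_contra hα
  set F := IntermediateField.adjoin K s
  have hsF : s ⊆ F := IntermediateField.subset_adjoin K s
  have hirr : Irreducible (Polynomial.X ^ p - Polynomial.C (⟨α ^ p,
      F.algebraMap_mem ⟨_, hpow α⟩⟩ : F)) := by
    refine X_pow_sub_C_irreducible_of_prime hp fun b hb ↦ hα ?_
    have : (b : k) ^ p = α ^ p := congr((($hb : F) : k))
    rw [← frobenius_inj k p this]
    exact b.2
  have hmin : (minpoly F α).natDegree = p := by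
    rw [← minpoly.eq_of_irreducible_of_monic hirr _ (Polynomial.monic_X_pow_sub_C _ hp.ne_zero),
      Polynomial.natDegree_X_pow_sub_C]
    simp only [map_sub, map_pow, Polynomial.aeval_X, Polynomial.aeval_C]
    exact sub_self _
  have hc := linearIndependent_pow (K := F) α
  let b : reducedExponents p s → F := fun e ↦
    ⟨monomialEval id (e : k →₀ ℕ), monomialEval_mem (fun i hi ↦ hsF hi) e.2.2⟩
  have hb : LinearIndependent K b := by
    refine LinearIndependent.of_comp F.val.toLinearMap ?_
    exact hs.prop
  have hbc := linearIndependent_smul hb hc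
  have hαs : α ∈ s := by
    refine hs.le_of_ge (y := insert α s) ?_ (Set.subset_insert α s) (Set.mem_insert α s)
    let φ : reducedExponents p (insert α s) →
        reducedExponents p s × Fin (minpoly F α).natDegree := fun e ↦
      (⟨(e : k →₀ ℕ).erase α, fun i ↦ by
        rw [Finsupp.erase_apply]; split_ifs
        · exact hp.pos
        · exact e.2.1 i, fun i hi ↦ by
        rw [Finsupp.support_erase, Finset.coe_erase] at hi
        exact (e.2.2 hi.1).resolve_left hi.2⟩, ⟨(e : k →₀ ℕ) α, by rw [hmin]; exact e.2.1 α⟩)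
    have hφ : Function.Injective φ := by
      intro e f hef
      have h1 : (e : k →₀ ℕ).erase α = (f : k →₀ ℕ).erase α := congr((($hef).1 : k →₀ ℕ))
      have h2 : (e : k →₀ ℕ) α = (f : k →₀ ℕ) α := congr((($hef).2 : ℕ))
      ext i
      by_cases hi : i = α
      · rw [hi, h2]
      · have := congr($h1 i)
        rwa [Finsupp.erase_ne hi, Finsupp.erase_ne hi] at this
    have h := hbc.comp φ hφ
    have hcomp : (fun e : reducedExponents p (insert α s) ↦ monomialEval (id : k → k) e) =
        (fun q : reducedExponents p s × Fin (minpoly F α).natDegree ↦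
          b q.1 • α ^ (q.2 : ℕ)) ∘ φ := by
      funext e
      change _ = monomialEval id ((e : k →₀ ℕ).erase α) * α ^ ((e : k →₀ ℕ) α)
      conv_lhs => rw [← Finsupp.erase_add_single α (e : k →₀ ℕ)]
      rw [monomialEval_add, monomialEval_single, id]
    change LinearIndependent K (fun e : reducedExponents p (insert α s) ↦
      monomialEval (id : k → k) e)
    rw [hcomp]
    exact h
  exact hα (hsF hαs)

end PBasis

section Frobenius

variable {k : Type} [Field k] (p : ℕ) [Fact p.Prime] [CharP k p]

theorem eq_zero_of_sum_pow_mul_monomialEval_eq_zero {s : Set k}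
    (hs : LinearIndepOn (frobenius k p).fieldRange (monomialEval (id : k → k))
      (reducedExponents p s)) (n : ℕ) (T : Finset (k →₀ ℕ))
    (hT : ∀ e ∈ T, e ∈ reducedExponents (p ^ n) s) (c : (k →₀ ℕ) → k)
    (h : ∑ e ∈ T, c e ^ p ^ n * monomialEval id e = 0) : ∀ e ∈ T, c e = 0 := by
  classical
  have hp : p.Prime := Fact.out
  induction n generalizing T c with
  | zero =>
    intro e he
    have h0 : ∀ f ∈ T, f = 0 := fun f hf ↦ by
      ext i
      simpa using (hT f hf).1 i
    obtain rfl := h0 e he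
    have hT : T = {0} := Finset.eq_singleton_iff_unique_mem.mpr ⟨he, h0⟩
    simpa [hT] using h
  | succ n ih =>
    let r : (k →₀ ℕ) → (k →₀ ℕ) := fun e ↦ e.mapRange (· % p) (Nat.zero_mod p)
    let q : (k →₀ ℕ) → (k →₀ ℕ) := fun e ↦ e.mapRange (· / p) (Nat.zero_div p)
    have hrq (e : k →₀ ℕ) : r e + p • q e = e := by
      ext i
      exact Nat.mod_add_div (e i) p
    have hinner (e₀ : k →₀ ℕ) : ∑ e ∈ T with r e = e₀, c e ^ p ^ n * monomialEval id (q e) =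
        ∑ f ∈ (T.filter fun e ↦ r e = e₀).image q,
          c (e₀ + p • f) ^ p ^ n * monomialEval id f := by
      rw [Finset.sum_image]
      · refine Finset.sum_congr rfl fun e he ↦ ?_
        rw [← (Finset.mem_filter.mp he).2, hrq]
      · intro e he f hf hef
        rw [← hrq e, ← hrq f, hef, (Finset.mem_filter.mp he).2, (Finset.mem_filter.mp hf).2]
    have hsum : ∑ e₀ ∈ T.image r, (∑ e ∈ T with r e = e₀,
        c e ^ p ^ n * monomialEval id (q e)) ^ p * monomialEval id e₀ = 0 := by
      rw [← h, ← Finset.sum_fiberwise_of_maps_to (s := T) (t := T.image r)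
        (fun e he ↦ Finset.mem_image_of_mem r he)]
      refine Finset.sum_congr rfl fun e₀ _ ↦ ?_
      rw [sum_pow_char, Finset.sum_mul]
      refine Finset.sum_congr rfl fun e he ↦ ?_
      rw [mul_pow, ← pow_mul, ← pow_succ, mul_assoc, ← (Finset.mem_filter.mp he).2,
        ← monomialEval_nsmul, mul_comm (monomialEval _ _), ← monomialEval_add, hrq]
    have hzero : ∀ e₀ ∈ T.image r, ∑ e ∈ T with r e = e₀,
        c e ^ p ^ n * monomialEval id (q e) = 0 := by
      have h1 := linearIndepOn_finset_iff.mp (hs.mono (t := ↑(T.image r)) fun e₀ he₀ ↦ by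
        obtain ⟨e, he, rfl⟩ := Finset.mem_image.mp (Finset.mem_coe.mp he₀)
        exact ⟨fun i ↦ Nat.mod_lt _ hp.pos, subset_trans
          (Finset.coe_subset.mpr Finsupp.support_mapRange) (hT e he).2⟩)
        (fun e₀ ↦ ⟨frobenius k p (∑ e ∈ T with r e = e₀, c e ^ p ^ n * monomialEval id (q e)),
          ⟨_, rfl⟩⟩) hsum
      intro e₀ he₀
      have := congr((($(h1 e₀ he₀) : (frobenius k p).fieldRange) : k))
      exact (map_eq_zero (frobenius k p)).mp this
    intro e he
    have h2 := hzero (r e) (Finset.mem_image_of_mem r he)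
    rw [hinner] at h2
    have := ih _ (fun f hf ↦ by
      obtain ⟨e', he', rfl⟩ := Finset.mem_image.mp hf
      have he'' := hT e' (Finset.mem_filter.mp he').1
      refine ⟨fun i ↦ Nat.div_lt_of_lt_mul ?_, subset_trans
          (Finset.coe_subset.mpr Finsupp.support_mapRange) he''.2⟩
      rw [← pow_succ']
      exact he''.1 i) _ h2 (q e)
      (Finset.mem_image_of_mem q (Finset.mem_filter.mpr ⟨he, rfl⟩))
    rwa [hrq] at this

theorem closure_range_iterateFrobenius_union {s : Set k}
    (hs : Submodule.span (frobenius k p).fieldRange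
      (monomialEval (id : k → k) '' reducedExponents p s) = ⊤) (n : ℕ) :
    Subring.closure (Set.range (iterateFrobenius k p n) ∪ s) = ⊤ := by
  induction n with
  | zero =>
    rw [eq_top_iff]
    exact fun x _ ↦ Subring.subset_closure (.inl ⟨x, by simp⟩)
  | succ n ih =>
    set L := Subring.closure (Set.range (iterateFrobenius k p (n + 1)) ∪ s)
    have hsL {x : k} (hx : x ∈ s) : x ∈ L := Subring.subset_closure (.inr hx)
    have h1 (x : k) : frobenius k p x ∈ L := by
      suffices h : Subring.closure (Set.range (iterateFrobenius k p n) ∪ s) ≤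
          L.comap (frobenius k p) from h (ih ▸ Subring.mem_top x)
      rw [Subring.closure_le]
      rintro _ (⟨y, rfl⟩ | hy)
      · refine Subring.subset_closure (.inl ⟨y, ?_⟩)
        rw [iterateFrobenius_def, iterateFrobenius_def, frobenius_def, ← pow_mul, pow_succ]
      · exact pow_mem (hsL hy) p
    rw [eq_top_iff]
    intro x _
    have hx : x ∈ Submodule.span (frobenius k p).fieldRange
      (monomialEval (id : k → k) '' reducedExponents p s) := hs ▸ Submodule.mem_top
    induction hx using Submodule.span_induction with
    | mem x hx =>
      obtain ⟨e, he, rfl⟩ := hx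
      exact monomialEval_mem (fun i hi ↦ hsL hi) he.2
    | zero => exact zero_mem _
    | add x y _ _ hx hy => exact add_mem (hx trivial) (hy trivial)
    | smul a x _ hx =>
      obtain ⟨_, ⟨a, rfl⟩⟩ := a
      exact mul_mem (h1 a) (hx trivial)

end Frobenius

section CoefficientRing

variable (D : Type) [CommRing D]

open WittVector

theorem WittVector.exists_ghostComponent_succ_eq (p : ℕ) [Fact p.Prime] (n : ℕ)
    (w : WittVector p D) :
    ∃ w' : WittVector p D, ghostComponent (n + 1) w =
      w.coeff 0 ^ p ^ (n + 1) + p * ghostComponent n w' := by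
  refine ⟨WittVector.mk p fun i ↦ w.coeff (i + 1), ?_⟩
  rw [ghostComponent_apply, ghostComponent_apply, aeval_wittPolynomial, aeval_wittPolynomial,
    Finset.sum_range_succ', add_comm, Finset.mul_sum]
  congr 1
  · simp
  · refine Finset.sum_congr rfl fun i _ ↦ ?_
    rw [WittVector.coeff_mk, Nat.add_sub_add_right]
    ring

variable [IsLocalRing D] [IsAdicComplete (maximalIdeal D) D]

theorem exists_isCoefficientRing_of_charZero [CharZero (ResidueField D)] :
    ∃ (Λ : Subring D) (π : Λ), IsCoefficientRing Λ π := by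
  have hQ (n : ℕ) (hn : n ≠ 0) : IsUnit (n : D) := by
    rw [← notMem_maximalIdeal, ← residue_eq_zero_iff, map_natCast]
    exact_mod_cast hn
  let : Algebra ℚ D := RingHom.toAlgebra <| IsLocalization.lift (M := nonZeroDivisors ℤ)
    (g := Int.castRingHom D) fun n ↦ by
      have hn := nonZeroDivisors.ne_zero n.2
      rcases Int.natAbs_eq (n : ℤ) with h | h
      · rw [h, map_natCast]
        exact hQ _ (by omega)
      · rw [h, map_neg, map_natCast]
        exact (hQ _ (by omega)).neg
  obtain ⟨t, ht⟩ := exists_isTranscendenceBasis ℚ (ResidueField D)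
  have := ht.isAlgebraic_field
  have := Algebra.FormallySmooth.of_algebraicIndependent_of_isSeparable ht.1
  obtain ⟨g, hg⟩ := Algebra.FormallySmooth.exists_mkₐ_comp_eq_of_isAdicComplete
    (R := ℚ) (A := ResidueField D) (S := D) (I := maximalIdeal D)
    (RingHom.toRatAlgHom (RingHom.id (ResidueField D)))
  have h1 (x : ResidueField D) : residue D (g x) = x := congr($hg x)
  refine ⟨g.range.toSubring, 0, fun d ↦ ⟨g (residue D d), ⟨_, rfl⟩, ?_⟩, ?_, zero_mem _, ?_⟩
  · rw [← residue_eq_zero_iff, map_sub, h1, sub_self]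
  · rintro ⟨_, ⟨x, rfl⟩⟩ hl
    have hx : x = 0 := by
      rw [← h1 x]
      exact (residue_eq_zero_iff _).mpr hl
    refine ⟨0, Subtype.ext ?_⟩
    simp [hx]
  · rw [Ideal.span_singleton_zero]
    infer_instance

variable [IsDomain D] [IsNoetherianRing D]

theorem exists_isCoefficientRing_of_charP (p : ℕ) [Fact p.Prime] [CharP (ResidueField D) p] :
    ∃ (Λ : Subring D) (π : Λ), IsCoefficientRing Λ π := by
  classical
  have hp : p.Prime := Fact.out
  obtain ⟨s, hs1, hs2⟩ := exists_pBasis (ResidueField D) p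
  have hpm : (p : D) ∈ maximalIdeal D := by
    rw [← residue_eq_zero_iff, map_natCast, CharP.cast_eq_zero]
  obtain ⟨B, hB⟩ := (residue_surjective (R := D)).hasRightInverse
  let R (n : ℕ) : Subring D := (ghostComponent n : WittVector p D →+* D).range
  let G (n : ℕ) : Subring D := (Algebra.adjoin (R n) (B '' s)).toSubring
  have hRG (n : ℕ) {x : D} (hx : x ∈ R n) : x ∈ G n :=
    (Algebra.adjoin (R n) (B '' s)).algebraMap_mem ⟨x, hx⟩
  have hBG (n : ℕ) {x : ResidueField D} (hx : x ∈ s) : B x ∈ G n :=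
    Algebra.subset_adjoin ⟨x, hx, rfl⟩
  have hG : Antitone G := by
    refine antitone_nat_of_succ_le fun n x hx ↦ ?_
    change x ∈ Algebra.adjoin (R (n + 1)) (B '' s) at hx
    induction hx using Algebra.adjoin_induction with
    | mem x hx =>
      obtain ⟨x, hx, rfl⟩ := hx
      exact hBG n hx
    | algebraMap r =>
      obtain ⟨_, w, rfl⟩ := r
      exact hRG n ⟨frobenius w, ghostComponent_frobenius n w⟩
    | add x y _ _ hx hy => exact add_mem hx hy
    | mul x y _ _ hx hy => exact mul_mem hx hy
  refine exists_isCoefficientRing_of_antitone p hpm G hG (fun n d ↦ ?_) fun n x hx hxm ↦ ?_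
  · have h1 : Subring.closure (Set.range (iterateFrobenius (ResidueField D) p n) ∪ s) ≤
        (G n).map (residue D) := by
      rw [Subring.closure_le]
      rintro _ (⟨y, rfl⟩ | hy)
      · obtain ⟨y, rfl⟩ := residue_surjective y
        refine ⟨y ^ p ^ n, hRG n ⟨teichmuller p y, ghostComponent_teichmuller p y n⟩, ?_⟩
        rw [map_pow, iterateFrobenius_def]
      · exact ⟨_, hBG n hy, hB _⟩
    rw [closure_range_iterateFrobenius_union p hs2] at h1
    obtain ⟨l, hl, hl'⟩ := h1 (Subring.mem_top (residue D d))
    refine ⟨l, hl, ?_⟩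
    rw [← residue_eq_zero_iff, map_sub, hl', sub_self]
  · obtain ⟨T, w, hT, rfl⟩ : ∃ (T : Finset (ResidueField D →₀ ℕ))
        (w : (ResidueField D →₀ ℕ) → WittVector p D),
        (∀ e ∈ T, e ∈ reducedExponents (p ^ (n + 1)) s) ∧
        x = ∑ e ∈ T, ghostComponent (n + 1) (w e) * monomialEval B e := by
      have h1 : x ∈ Submodule.span (R (n + 1))
          (monomialEval B '' reducedExponents (p ^ (n + 1)) s) := by
        change x ∈ Subalgebra.toSubmodule (Algebra.adjoin (R (n + 1)) (B '' s)) at hx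
        rw [Algebra.adjoin_eq_span] at hx
        refine Submodule.span_le.mpr ?_ hx
        intro y hy
        obtain ⟨f, hf, rfl⟩ := exists_eq_monomialEval_of_mem_closure hy
        obtain ⟨e, he, g, -, rfl⟩ := exists_reducedExponents_add_nsmul (pow_pos hp.pos (n + 1)) hf
        rw [monomialEval_add, monomialEval_nsmul, mul_comm]
        exact Submodule.smul_mem _ (⟨_, teichmuller p (monomialEval B g),
          ghostComponent_teichmuller p _ (n + 1)⟩ : R (n + 1))
          (Submodule.subset_span ⟨e, he, rfl⟩)
      obtain ⟨l, hl, rfl⟩ := (Finsupp.mem_span_image_iff_linearCombination _).mp h1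
      choose w hw using fun e ↦ (l e).2
      refine ⟨l.support, w, fun e he ↦ hl he, ?_⟩
      rw [Finsupp.linearCombination_apply, Finsupp.sum]
      refine Finset.sum_congr rfl fun e _ ↦ ?_
      rw [hw]
      rfl
    choose w' hw' using fun e ↦ exists_ghostComponent_succ_eq D p n (w e)
    have h0 : ∀ e ∈ T, residue D ((w e).coeff 0) = 0 := by
      refine eq_zero_of_sum_pow_mul_monomialEval_eq_zero p hs1 (n + 1) T hT
        (fun e ↦ residue D ((w e).coeff 0)) ?_
      rw [← residue_eq_zero_iff, map_sum] at hxm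
      rw [← hxm]
      refine Finset.sum_congr rfl fun e _ ↦ ?_
      rw [hw', map_mul, map_add, map_mul, map_natCast, CharP.cast_eq_zero, zero_mul, add_zero,
        map_pow]
      congr 1
      refine ((map_monomialEval (residue D : D →* ResidueField D) B e).trans ?_).symm
      congr 1
      funext i
      exact hB i
    refine ⟨∑ e ∈ T, ghostComponent n (w' e) * monomialEval B e, sum_mem fun e he ↦
      mul_mem (hRG n ⟨_, rfl⟩) (monomialEval_mem (fun i hi ↦ hBG n hi) (hT e he).2), ?_⟩
    rw [Finset.mul_sum, ← Finset.sum_sub_distrib]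
    refine sum_mem fun e he ↦ ?_
    rw [hw', add_mul, mul_assoc, add_sub_cancel_right]
    refine Ideal.mul_mem_right _ _ (Ideal.pow_le_pow_right (Nat.lt_pow_self hp.one_lt)
      (Ideal.pow_mem_pow ((residue_eq_zero_iff _).mp (h0 e he)) _))

theorem exists_isCoefficientRing : ∃ (Λ : Subring D) (π : Λ), IsCoefficientRing Λ π := by
  obtain ⟨p, hp⟩ := CharP.exists (ResidueField D)
  rcases CharP.char_is_prime_or_zero (ResidueField D) p with h | rfl
  · have : Fact p.Prime := ⟨h⟩
    exact exists_isCoefficientRing_of_charP D p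
  · have := CharP.charP_to_charZero (ResidueField D)
    exact exists_isCoefficientRing_of_charZero D

end CoefficientRing

namespace IsCoefficientRing

variable {D : Type} [CommRing D] [IsLocalRing D] {Λ : Subring D} {π : Λ}

theorem isUnit_of_notMem (h : IsCoefficientRing Λ π) {l : Λ} (hl : (l : D) ∉ maximalIdeal D) :
    IsUnit l := by
  have := h.isAdicComplete
  obtain ⟨y, hy⟩ := (notMem_maximalIdeal.mp hl).exists_right_inv
  obtain ⟨l', hl', hyl⟩ := h.exists_sub_mem y
  obtain ⟨μ, hμ⟩ := h.dvd_of_mem (1 - l * ⟨l', hl'⟩) (by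
    have := Ideal.mul_mem_left _ (l : D) hyl
    convert! this using 1
    push_cast
    rw [mul_sub, hy])
  have hπ : π ∈ (⊥ : Ideal Λ).jacobson :=
    IsAdicComplete.le_jacobson_bot (Ideal.span {π}) (Ideal.mem_span_singleton_self π)
  have h1 := Ideal.mem_jacobson_bot.mp hπ (-μ)
  have h2 : π * -μ + 1 = l * ⟨l', hl'⟩ := by
    rw [mul_neg, ← hμ]
    ring
  rw [h2] at h1
  exact isUnit_of_mul_isUnit_left h1

theorem isField (h : IsCoefficientRing Λ 0) : IsField Λ where
  exists_pair_ne := ⟨0, 1, zero_ne_one⟩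
  mul_comm := mul_comm
  mul_inv_cancel {a} ha := by
    refine (h.isUnit_of_notMem fun hm ↦ ha ?_).exists_right_inv
    exact zero_dvd_iff.mp (h.dvd_of_mem a hm)

theorem ringKrullDim_eq_zero (h : IsCoefficientRing Λ 0) : ringKrullDim Λ = 0 :=
  ringKrullDim_eq_zero_of_isField h.isField

variable [IsNoetherianRing D]

theorem exists_associated_pow (h : IsCoefficientRing Λ π) {l : Λ} (hl : l ≠ 0) :
    ∃ n : ℕ, Associated (π ^ n) l := by
  have hex : ∃ n : ℕ, ¬ π ^ n ∣ l := by
    by_contra! hall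
    refine hl (Subtype.ext ?_)
    have : (l : D) ∈ ⨅ n : ℕ, maximalIdeal D ^ n := by
      rw [Ideal.mem_iInf]
      intro n
      obtain ⟨μ, rfl⟩ := hall n
      exact Ideal.mul_mem_right _ _ (Ideal.pow_mem_pow h.mem n)
    rwa [Ideal.iInf_pow_eq_bot_of_isLocalRing _ (maximalIdeal.isMaximal D).ne_top] at this
  classical
  obtain ⟨n, hn⟩ : ∃ n, Nat.find hex = n + 1 := Nat.exists_eq_succ_of_ne_zero fun h0 ↦ by
    have := Nat.find_spec hex
    rw [h0] at this
    simp at this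
  have h1 := Nat.find_spec hex
  rw [hn] at h1
  obtain ⟨u, hu⟩ : π ^ n ∣ l := not_not.mp (Nat.find_min hex (by omega))
  refine ⟨n, ?_⟩
  by_cases hum : (u : D) ∈ maximalIdeal D
  · obtain ⟨v, rfl⟩ := h.dvd_of_mem u hum
    exact absurd ⟨v, by rw [hu]; ring⟩ h1
  · obtain ⟨u, rfl⟩ := h.isUnit_of_notMem hum
    exact ⟨u, hu.symm⟩

theorem exists_finset_span_sup_pow (h : IsCoefficientRing Λ π) (n : ℕ) :
    ∃ F : Finset D, ∀ x : D, ∃ y ∈ Submodule.span Λ (F : Set D), x - y ∈ maximalIdeal D ^ n := by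
  classical
  induction n with
  | zero => exact ⟨∅, fun x ↦ ⟨0, zero_mem _, by simp⟩⟩
  | succ n ih =>
    obtain ⟨F, hF⟩ := ih
    obtain ⟨T, hT⟩ := IsNoetherian.noetherian (maximalIdeal D ^ n)
    have h1 : ∀ x ∈ Submodule.span D (T : Set D), ∃ y ∈ Submodule.span Λ (T : Set D),
        x - y ∈ maximalIdeal D ^ (n + 1) := by
      intro x hx
      induction hx using Submodule.span_induction with
      | mem x hx => exact ⟨x, Submodule.subset_span hx, by simp⟩
      | zero => exact ⟨0, zero_mem _, by simp⟩
      | add a b _ _ ha hb =>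
        obtain ⟨y, hy, hay⟩ := ha
        obtain ⟨z, hz, hbz⟩ := hb
        refine ⟨y + z, add_mem hy hz, ?_⟩
        rw [add_sub_add_comm]
        exact add_mem hay hbz
      | smul a x hx ih =>
        obtain ⟨y, hy, hxy⟩ := ih
        obtain ⟨l, hl, hal⟩ := h.exists_sub_mem a
        refine ⟨(⟨l, hl⟩ : Λ) • y, Submodule.smul_mem _ _ hy, ?_⟩
        rw [hT] at hx
        have h2 := add_mem (Ideal.mul_mem_left _ l hxy) (pow_succ' (maximalIdeal D) n ▸
          Ideal.mul_mem_mul hal hx)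
        convert! h2 using 1
        rw [Subring.smul_def, smul_eq_mul, smul_eq_mul]
        ring
    refine ⟨F ∪ T, fun x ↦ ?_⟩
    obtain ⟨y, hy, hxy⟩ := hF x
    obtain ⟨z, hz, hxz⟩ := h1 (x - y) (by rwa [hT])
    refine ⟨y + z, add_mem (Submodule.span_mono (by simp) hy)
      (Submodule.span_mono (by simp) hz), ?_⟩
    rwa [← sub_sub]

theorem finite_of_isAdicComplete [IsAdicComplete (maximalIdeal D) D] (h : IsCoefficientRing Λ π)
    {S : Type} [CommRing S] (φ : S →+* D) (g : Λ →+* S) (hg : φ.comp g = Λ.subtype) (I : Ideal S)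
    [IsAdicComplete I S] (hI : I.map φ ≤ maximalIdeal D) {n : ℕ}
    (hn : maximalIdeal D ^ n ≤ I.map φ) : φ.Finite := by
  refine RingHom.finite_of_isAdicComplete φ I (maximalIdeal D) hI ?_
  refine RingHom.Finite.of_comp_finite (f := g) ?_
  rw [RingHom.comp_assoc, hg]
  obtain ⟨F, hF⟩ := h.exists_finset_span_sup_pow n
  classical
  have halg : (Ideal.Quotient.mk (I.map φ)).comp Λ.subtype = algebraMap Λ (D ⧸ I.map φ) := rfl
  rw [halg, RingHom.finite_algebraMap]
  let q : D →ₗ[Λ] D ⧸ I.map φ := (Ideal.Quotient.mkₐ Λ (I.map φ)).toLinearMap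
  refine ⟨⟨F.image q, ?_⟩⟩
  rw [eq_top_iff, Finset.coe_image, ← Submodule.map_span]
  rintro x -
  obtain ⟨x, rfl⟩ := Ideal.Quotient.mk_surjective x
  obtain ⟨y, hy, hxy⟩ := hF x
  refine ⟨y, hy, ?_⟩
  rw [eq_comm]
  exact Ideal.Quotient.eq.mpr (hn hxy)

variable [IsDomain D]

theorem isDiscreteValuationRing (h : IsCoefficientRing Λ π) (hπ : π ≠ 0) :
    IsDiscreteValuationRing Λ := by
  have hnu : ¬ IsUnit π := fun hu ↦ (mem_maximalIdeal _).mp h.mem (hu.map Λ.subtype)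
  refine IsDiscreteValuationRing.ofHasUnitMulPowIrreducibleFactorization
    ⟨π, ⟨hnu, fun a b hab ↦ ?_⟩, fun hx ↦ h.exists_associated_pow hx⟩
  by_contra! hcon
  obtain ⟨a', rfl⟩ := h.dvd_of_mem a (not_not.mp fun hh ↦ hcon.1 (h.isUnit_of_notMem hh))
  obtain ⟨b', rfl⟩ := h.dvd_of_mem b (not_not.mp fun hh ↦ hcon.2 (h.isUnit_of_notMem hh))
  refine hnu (.of_mul_eq_one (a' * b') (mul_left_cancel₀ hπ ?_))
  linear_combination -hab

theorem isNoetherianRing (h : IsCoefficientRing Λ π) : IsNoetherianRing Λ := by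
  rcases eq_or_ne π 0 with rfl | hπ
  · let := h.isField.toField
    infer_instance
  · have := h.isDiscreteValuationRing hπ
    infer_instance

theorem ringKrullDim_eq_one (h : IsCoefficientRing Λ π) (hπ : π ≠ 0) : ringKrullDim Λ = 1 := by
  have := h.isDiscreteValuationRing hπ
  exact IsDiscreteValuationRing.ringKrullDim_eq_one Λ

end IsCoefficientRing

section Colon

/-- A finite torsion-free module over a domain is, up to a nonzero scalar, free. -/
theorem Module.exists_linearMap_comp_eq_smul (S M : Type) [CommRing S] [IsDomain S]
    [AddCommGroup M] [Module S M] [Module.Finite S M] :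
    ∃ (ι : Type) (f : (ι →₀ S) →ₗ[S] M) (h : M →ₗ[S] (ι →₀ S)) (c : S), c ≠ 0 ∧
      ∀ m, f (h m) = c • m := by
  classical
  obtain ⟨s, hs, hmax⟩ := exists_maximal_linearIndepOn S (id : M → M)
  have h1 (m : M) : ∃ a : S, a ≠ 0 ∧ a • m ∈ Submodule.span S (Set.range fun i : s ↦ (i : M)) := by
    have hr : (Set.range fun i : s ↦ (i : M)) = id '' s := by simp
    rw [hr]
    by_cases hm : m ∈ s
    · exact ⟨1, one_ne_zero, by rw [one_smul]; exact Submodule.subset_span ⟨m, hm, rfl⟩⟩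
    · exact hmax m hm
  choose a ha ham using h1
  obtain ⟨T, hT⟩ := Module.Finite.fg_top (R := S) (M := M)
  let c := ∏ m ∈ T, a m
  have hc (m : M) : c • m ∈ Submodule.span S (Set.range fun i : s ↦ (i : M)) := by
    have : m ∈ Submodule.span S (T : Set M) := hT ▸ Submodule.mem_top
    induction this using Submodule.span_induction with
    | mem m hm =>
      rw [show c = _ from (Finset.prod_erase_mul T a hm).symm, mul_smul]
      exact Submodule.smul_mem _ _ (ham m)
    | zero => simp
    | add x y _ _ hx hy => rw [smul_add]; exact add_mem hx hy
    | smul b x _ hx => rw [smul_comm]; exact Submodule.smul_mem _ _ hx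
  have hli : LinearIndependent S fun i : s ↦ (i : M) := hs
  refine ⟨s, Finsupp.linearCombination S fun i : s ↦ (i : M),
    hli.repr ∘ₗ (LinearMap.lsmul S M c).codRestrict _ hc, c,
    Finset.prod_ne_zero_iff.mpr fun m _ ↦ ha m, fun m ↦ ?_⟩
  rw [LinearMap.comp_apply, LinearIndependent.linearCombination_repr]
  rfl

theorem PowerSeries.dvd_of_C_dvd_mul_X_pow {S : Type} [CommRing S] {x : S} {m : ℕ}
    {a : PowerSeries S} (h : C x ∣ X ^ m * a) : C x ∣ a := by
  obtain ⟨b, hb⟩ := h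
  have h1 (n : ℕ) : coeff n a = x * coeff (n + m) b := by
    rw [← coeff_C_mul, ← hb, coeff_X_pow_mul]
  refine ⟨PowerSeries.mk fun n ↦ coeff (n + m) b, ?_⟩
  ext n
  rw [h1, coeff_C_mul, coeff_mk]

theorem exists_ne_zero_mul_mem_span_pow {S D : Type} [CommRing S] [IsDomain S] [CommRing D]
    [IsDomain D] (φ : PowerSeries S →+* D) (hφ : φ.Finite) (hinj : Function.Injective φ) (x : S) :
    ∃ c : D, c ≠ 0 ∧ ∀ (k m : ℕ) (a : D), φ (PowerSeries.C x) ^ k ∣ a * φ PowerSeries.X ^ m →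
      φ (PowerSeries.C x) ^ k ∣ c * a := by
  algebraize [φ]
  obtain ⟨ι, f, h, c, hc, hfh⟩ := Module.exists_linearMap_comp_eq_smul (PowerSeries S) D
  refine ⟨φ c, by rwa [Ne, map_eq_zero_iff φ hinj], fun k m a ⟨b, hb⟩ ↦ ?_⟩
  have h1 : (PowerSeries.X : PowerSeries S) ^ m • a = (PowerSeries.C x ^ k) • b := by
    rw [Algebra.smul_def, Algebra.smul_def, map_pow, map_pow, mul_comm]
    exact hb
  have h2 (i : ι) : PowerSeries.C x ^ k ∣ h a i := by
    have := congr($(congrArg h h1) i)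
    rw [map_smul, map_smul, Finsupp.smul_apply, Finsupp.smul_apply, smul_eq_mul, smul_eq_mul,
      ← map_pow PowerSeries.C] at this
    rw [← map_pow PowerSeries.C]
    exact PowerSeries.dvd_of_C_dvd_mul_X_pow ⟨_, this⟩
  choose t ht using h2
  classical
  obtain ⟨T, hT⟩ : ∃ T : ι →₀ PowerSeries S, h a = (PowerSeries.C x ^ k) • T := by
    refine ⟨Finsupp.onFinset (h a).support (fun i ↦ if h a i = 0 then 0 else t i) fun i hi ↦
      Finsupp.mem_support_iff.mpr fun h0 ↦ hi (if_pos h0), ?_⟩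
    ext1 i
    rw [Finsupp.smul_apply, Finsupp.onFinset_apply, smul_eq_mul]
    split_ifs with h0
    · rw [h0, mul_zero]
    · exact ht i
  refine ⟨f T, ?_⟩
  have h4 := hfh a
  rw [hT, map_smul, Algebra.smul_def, Algebra.smul_def, map_pow] at h4
  exact h4.symm

end Colon

section Dimension

variable {R : Type} [CommRing R]

theorem Ideal.ringKrullDim_quotient_le_of_forall_minimalPrimes {I : Ideal R} {N : WithBot ℕ∞}
    (h : ∀ q ∈ I.minimalPrimes, ringKrullDim (R ⧸ q) ≤ N) : ringKrullDim (R ⧸ I) ≤ N := by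
  rw [ringKrullDim_quotient]
  refine iSup_le fun p ↦ ?_
  have hI : I ≤ (p.head.1.asIdeal) := p.head.2
  obtain ⟨q, hq, hqp⟩ := Ideal.exists_minimalPrimes_le hI
  refine le_trans ?_ (h q hq)
  rw [ringKrullDim_quotient]
  let p' : LTSeries (PrimeSpectrum.zeroLocus (q : Set R)) :=
    { length := p.length
      toFun := fun i ↦ ⟨p i, hqp.trans (p.head_le i)⟩
      step := p.step }
  exact Order.LTSeries.length_le_krullDim p'

theorem Ideal.ringKrullDim_quotient_mono {I J : Ideal R} (h : I ≤ J) :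
    ringKrullDim (R ⧸ J) ≤ ringKrullDim (R ⧸ I) :=
  ringKrullDim_le_of_surjective _ (Ideal.Quotient.factor_surjective h)

theorem Ideal.ringKrullDim_quotient_add_one_le {q J : Ideal R} [q.IsPrime] (h : q ≤ J) {z : R}
    (hzJ : z ∈ J) (hzq : z ∉ q) : ringKrullDim (R ⧸ J) + 1 ≤ ringKrullDim (R ⧸ q) := by
  have h1 : Ideal.Quotient.mk q z ∈ nonZeroDivisors (R ⧸ q) :=
    mem_nonZeroDivisors_of_ne_zero (by rwa [Ne, Ideal.Quotient.eq_zero_iff_mem])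
  have h2 := ringKrullDim_quotient_succ_le_of_nonZeroDivisor h1
  rw [← Set.image_singleton, ← Ideal.map_span,
    ringKrullDim_eq_of_ringEquiv (DoubleQuot.quotQuotEquivQuotSup q (Ideal.span {z}))] at h2
  refine le_trans ?_ h2
  gcongr
  exact Ideal.ringKrullDim_quotient_mono (sup_le h ((Ideal.span_singleton_le_iff_mem _).mpr hzJ))

theorem WithBot.le_of_add_one_le {x : WithBot ℕ∞} {n : ℕ} (h : x + 1 ≤ ((n + 1 : ℕ) : WithBot ℕ∞)) :
    x ≤ n := by
  induction x using WithBot.recBotCoe with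
  | bot => exact bot_le
  | coe x =>
    induction x using ENat.recTopCoe with
    | top =>
      have h1 : (⊤ : ℕ∞) + 1 ≤ ((n + 1 : ℕ) : ℕ∞) := by exact_mod_cast h
      rw [top_add, top_le_iff] at h1
      exact absurd h1 (ENat.natCast_ne_top _)
    | coe x =>
      have h1 : x + 1 ≤ n + 1 := by exact_mod_cast h
      exact_mod_cast Nat.le_of_add_le_add_right h1

theorem RingHom.injective_of_finite_of_ringKrullDim_eq {S D : Type} [CommRing S] [IsDomain S]
    [CommRing D] (φ : S →+* D) (hφ : φ.Finite) {d : ℕ} (hS : ringKrullDim S = d)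
    (hD : ringKrullDim D = d) : Function.Injective φ := by
  rw [injective_iff_map_eq_zero]
  by_contra! h
  obtain ⟨s, hs, hs0⟩ := h
  have h1 : ringKrullDim D ≤ ringKrullDim (S ⧸ RingHom.ker φ) := by
    let := φ.toAlgebra
    have : Algebra.IsIntegral S D := ⟨hφ.to_isIntegral⟩
    rw [ringKrullDim_quotient]
    refine Order.krullDim_le_of_strictMono (fun P ↦ ⟨P.comap φ, fun x hx ↦ ?_⟩) fun P Q hPQ ↦ ?_
    · change φ x ∈ P.asIdeal
      rw [(RingHom.mem_ker).mp hx]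
      exact zero_mem _
    · obtain ⟨x, hxQ, hxP⟩ := SetLike.exists_of_lt (show P.asIdeal < Q.asIdeal from hPQ)
      exact Ideal.comap_lt_comap_of_integral_mem_sdiff (R := S) hPQ.le ⟨hxQ, hxP⟩
        (Algebra.IsIntegral.isIntegral x)
  have h2 := Ideal.ringKrullDim_quotient_add_one_le (q := ⊥) bot_le
    (show s ∈ RingHom.ker φ from hs) (by simpa using hs0)
  rw [ringKrullDim_eq_of_ringEquiv (RingEquiv.quotientBot S), hS] at h2
  have h3 := (add_le_add_left (hD ▸ h1) 1).trans h2
  norm_cast at h3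
  omega

theorem Ideal.exists_mem_forall_notMem_of_finite (P : Ideal R) {s : Set (Ideal R)} (hs : s.Finite)
    (h : ∀ q ∈ s, q.IsPrime ∧ ¬ P ≤ q) : ∃ z ∈ P, ∀ q ∈ s, z ∉ q := by
  by_contra! hcon
  obtain ⟨q, hq, hPq⟩ := (Ideal.subset_union_prime_finite hs (f := id) ⊥ ⊥
    fun q hq _ _ ↦ (h q hq).1).mp fun z hz ↦ by
      obtain ⟨q, hq, hzq⟩ := hcon z hz
      exact Set.mem_biUnion hq hzq
  exact (h q hq).2 hPq

/-- Avoiding the minimal primes of `J` not containing `P` lowers the dimension of `R ⧸ J`. -/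
theorem Ideal.exists_mem_ringKrullDim_quotient_sup_le [IsNoetherianRing R] {J P : Ideal R} {n : ℕ}
    {s : Set (Ideal R)} (hs : s.Finite) (h : ∀ q ∈ s, q.IsPrime ∧ ¬ P ≤ q)
    (hJ : ringKrullDim (R ⧸ J) ≤ ((n + 1 : ℕ) : WithBot ℕ∞))
    (hJP : ringKrullDim (R ⧸ (J ⊔ P)) ≤ n) :
    ∃ z ∈ P, (∀ q ∈ s, z ∉ q) ∧ ringKrullDim (R ⧸ (J ⊔ Ideal.span {z})) ≤ n := by
  obtain ⟨z, hzP, hz⟩ := P.exists_mem_forall_notMem_of_finite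
    (s := s ∪ {q | q ∈ J.minimalPrimes ∧ ¬ P ≤ q})
    (hs.union (J.finite_minimalPrimes_of_isNoetherianRing R |>.subset fun q hq ↦ hq.1)) (by
      rintro q (hq | hq)
      exacts [h q hq, ⟨hq.1.isPrime, hq.2⟩])
  refine ⟨z, hzP, fun q hq ↦ hz q (.inl hq), ?_⟩
  refine Ideal.ringKrullDim_quotient_le_of_forall_minimalPrimes fun Q hQ ↦ ?_
  have := hQ.isPrime
  have hJQ : J ≤ Q := le_sup_left.trans hQ.le
  have hzQ : z ∈ Q := hQ.le (Ideal.mem_sup_right (Ideal.mem_span_singleton_self z))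
  obtain ⟨q, hq, hqQ⟩ := Ideal.exists_minimalPrimes_le hJQ
  by_cases hPq : P ≤ q
  · exact (Ideal.ringKrullDim_quotient_mono (sup_le hJQ (hPq.trans hqQ))).trans hJP
  · have := hq.isPrime
    refine WithBot.le_of_add_one_le ((Ideal.ringKrullDim_quotient_add_one_le hqQ hzQ
      (hz q (.inr ⟨hq, hPq⟩))).trans ((Ideal.ringKrullDim_quotient_mono hq.le).trans hJ))

theorem IsLocalRing.exists_list_maximalIdeal_pow_le [IsLocalRing R] [IsNoetherianRing R]
    {J : Ideal R} (hJ : J ≤ maximalIdeal R) {r : ℕ} (h : ringKrullDim (R ⧸ J) ≤ r) :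
    ∃ (l : List R) (N : ℕ), (∀ a ∈ l, a ∈ maximalIdeal R) ∧ l.length = r ∧
      maximalIdeal R ^ N ≤ J ⊔ Ideal.span {a | a ∈ l} := by
  classical
  have hJ1 : J ≠ ⊤ := fun h ↦ (maximalIdeal.isMaximal R).ne_top (top_le_iff.mp (h ▸ hJ))
  have := Ideal.Quotient.nontrivial_iff.mpr hJ1
  have : IsLocalRing (R ⧸ J) := .of_surjective' _ Ideal.Quotient.mk_surjective
  obtain ⟨s, hs, hcard⟩ :=
    Ideal.exists_finset_card_eq_height_of_isNoetherianRing (maximalIdeal (R ⧸ J))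
  have hsr : s.card ≤ r := by
    rw [← IsLocalRing.maximalIdeal_height_eq_ringKrullDim, ← hcard] at h
    exact_mod_cast h
  obtain ⟨N, hN⟩ := Ideal.exists_pow_le_of_le_radical_of_fg_radical
    (I := maximalIdeal (R ⧸ J)) (J := Ideal.span s) (by
      rw [Ideal.radical_eq_sInf]
      exact le_sInf fun Q ⟨hQ, hQ'⟩ ↦ hs.2 ⟨hQ', hQ⟩ (le_maximalIdeal hQ'.ne_top))
    (IsNoetherian.noetherian _)
  obtain ⟨t, ht⟩ := (Ideal.Quotient.mk_surjective (I := J)).hasRightInverse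
  have hcomap : (maximalIdeal (R ⧸ J)).comap (Ideal.Quotient.mk J) = maximalIdeal R :=
    (IsLocalRing.eq_maximalIdeal (Ideal.comap_isMaximal_of_surjective _
      Ideal.Quotient.mk_surjective))
  refine ⟨s.toList.map t ++ List.replicate (r - s.card) 0, N, fun a ha ↦ ?_, ?_, ?_⟩
  · rcases List.mem_append.mp ha with h | h
    · obtain ⟨b, hb, rfl⟩ := List.mem_map.mp h
      rw [← hcomap, Ideal.mem_comap, ht]
      exact hs.le (Ideal.subset_span (Finset.mem_toList.mp hb))
    · rw [(List.mem_replicate.mp h).2]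
      exact zero_mem _
  · rw [List.length_append, List.length_map, Finset.length_toList, List.length_replicate]
    omega
  · have h1 : maximalIdeal R ^ N ≤ (Ideal.span (s : Set (R ⧸ J))).comap (Ideal.Quotient.mk J) := by
      rw [← Ideal.map_le_iff_le_comap, Ideal.map_pow]
      refine (Ideal.pow_right_mono ?_ N).trans hN
      rw [Ideal.map_le_iff_le_comap, hcomap]
    have h2 : Ideal.span (s : Set (R ⧸ J)) =
        (Ideal.span (t '' s)).map (Ideal.Quotient.mk J) := by
      rw [Ideal.map_span, Set.image_image]
      simp [ht _]
    rw [h2, Ideal.comap_map_of_surjective _ Ideal.Quotient.mk_surjective,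
      ← RingHom.ker_eq_comap_bot,
      Ideal.mk_ker] at h1
    refine h1.trans (sup_le (le_sup_of_le_right (Ideal.span_mono ?_)) le_sup_left)
    rintro _ ⟨b, hb, rfl⟩
    exact List.mem_append.mpr (.inl (List.mem_map.mpr ⟨b, Finset.mem_toList.mpr hb, rfl⟩))

end Dimension

theorem Ideal.mem_minimalPrimes_span_of_height_eq_one {D : Type}
    [CommRing D] [IsDomain D] [IsNoetherianRing D] {P : Ideal D} [P.IsPrime]
    (hP : P.height = 1) {x : D} (hx : x ∈ P) (hx0 : x ≠ 0) :
    P ∈ (Ideal.span {x}).minimalPrimes := by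
  obtain ⟨q, hq, hqP⟩ :=
    Ideal.exists_minimalPrimes_le ((Ideal.span_singleton_le_iff_mem _).mpr hx)
  have := hq.isPrime
  rcases hqP.eq_or_lt with rfl | hlt
  · exact hq
  · have h1 : (⊥ : Ideal D) < q := bot_lt_iff_ne_bot.mpr fun h ↦ hx0 (by
      have := hq.le (Ideal.mem_span_singleton_self x)
      rwa [h, Ideal.mem_bot] at this)
    have h2 := Ideal.height_add_one_le_of_lt_of_isPrime h1
    have h3 := Ideal.height_add_one_le_of_lt_of_isPrime hlt
    rw [hP, ENat.add_one_le_iff (Ideal.height_ne_top hq.isPrime.ne_top)] at h3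
    simp_all

section HeightOne

variable {D : Type} [CommRing D] [IsDomain D] [IsLocalRing D] [IsNoetherianRing D]
  [IsAdicComplete (maximalIdeal D) D]

theorem IsCoefficientRing.false_of_parameters {Λ : Subring D} {π : Λ} (h : IsCoefficientRing Λ π)
    {P : Ideal D} [P.IsPrime] {x z : D} (hx0 : x ≠ 0) (hP : P ∈ (Ideal.span {x}).minimalPrimes)
    (hzP : z ∈ P) (hz : ∀ q ∈ (Ideal.span {x}).minimalPrimes, q ≠ P → z ∉ q) {l : List D}
    (hl : ∀ a ∈ l, a ∈ maximalIdeal D) (hx : x = π ∨ x ∈ l) {N : ℕ}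
    (hN : maximalIdeal D ^ N ≤ Ideal.span {(π : D)} ⊔ Ideal.span {z} ⊔ Ideal.span {a | a ∈ l})
    {d : ℕ} (hd : ringKrullDim D = d) (hΛ : ringKrullDim Λ + l.length + 1 = d) : False := by
  classical
  have hPm : P ≤ maximalIdeal D := le_maximalIdeal (Ideal.IsPrime.ne_top inferInstance)
  have := h.isNoetherianRing
  have := h.isAdicComplete
  obtain ⟨S, _, _, I, _, g, φ, hgφ, hI, hdom, hdim, hrange⟩ :=
    PowerSeries.exists_iterated (maximalIdeal D) (Ideal.span {π}) Λ.subtype l hl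
  have := hdom inferInstance
  obtain ⟨Φ, hΦC, hΦX⟩ := PowerSeries.exists_ringHom_eval (maximalIdeal D) φ (hPm hzP)
  obtain ⟨X, rfl⟩ : ∃ X, φ X = x := by
    rcases hx with rfl | hx
    · exact ⟨g π, congr($hgφ π)⟩
    · exact hrange hx
  have hΦI : (I.map PowerSeries.C ⊔ Ideal.span {PowerSeries.X}).map Φ =
      Ideal.span {(π : D)} ⊔ Ideal.span {z} ⊔ Ideal.span {a | a ∈ l} := by
    rw [Ideal.map_sup, Ideal.map_map, hΦC, Ideal.map_span, Set.image_singleton, hΦX, hI,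
      Ideal.map_span, Set.image_singleton, sup_right_comm]
    rfl
  have := PowerSeries.isAdicComplete_map_sup_span_X I
  have hfin : Φ.Finite := by
    refine h.finite_of_isAdicComplete Φ (PowerSeries.C.comp g) ?_
      (I.map PowerSeries.C ⊔ Ideal.span {PowerSeries.X}) ?_ (hΦI ▸ hN)
    · rw [← RingHom.comp_assoc, hΦC, hgφ]
    · rw [hΦI]
      refine sup_le (sup_le ?_ ?_) (Ideal.span_le.mpr hl) <;>
        rw [Ideal.span_singleton_le_iff_mem]
      exacts [h.mem, hPm hzP]
  have hinj := RingHom.injective_of_finite_of_ringKrullDim_eq Φ hfin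
    (by rw [PowerSeries.ringKrullDim_eq_add_one, hdim, hΛ]) hd
  obtain ⟨c, hc0, hc⟩ := exists_ne_zero_mul_mem_span_pow Φ hfin hinj X
  rw [show Φ (PowerSeries.C X) = φ X from congr($hΦC X), hΦX] at hc
  have hfinite := (Ideal.span {φ X}).finite_minimalPrimes_of_isNoetherianRing D
  obtain ⟨y, hyP, hy⟩ : ∃ y ∉ P, ∀ q ∈ (Ideal.span {φ X}).minimalPrimes, q ≠ P → y ∈ q := by
    by_contra! hcon
    obtain ⟨q, hq, hqP⟩ := (Ideal.IsPrime.inf_le' (s := hfinite.toFinset.erase P) (f := id)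
      (P := P) inferInstance).mp fun y hy ↦ by
        by_contra hyP
        obtain ⟨q, hq, hqP, hyq⟩ := hcon y hyP
        refine hyq (Finset.inf_le (f := id) (Finset.mem_erase.mpr ⟨hqP, ?_⟩) hy)
        exact hfinite.mem_toFinset.mpr hq
    have hq' := hfinite.mem_toFinset.mp (Finset.mem_of_mem_erase hq)
    exact Finset.ne_of_mem_erase hq (le_antisymm hqP (hP.2 ⟨hq'.isPrime, hq'.le⟩ hqP))
  obtain ⟨n, hn⟩ : y * z ∈ (Ideal.span {φ X}).radical := by
    rw [← Ideal.sInf_minimalPrimes, Ideal.mem_sInf]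
    intro q hq
    by_cases hqP : q = P
    · exact hqP ▸ P.mul_mem_left _ hzP
    · exact q.mul_mem_right _ (hy q hq hqP)
  rw [Ideal.mem_span_singleton, mul_pow] at hn
  have h1 (k : ℕ) : φ X ^ k ∣ c * (y ^ n) ^ k := by
    refine hc k (n * k) _ ?_
    rw [pow_mul, ← mul_pow]
    exact pow_dvd_pow_of_dvd hn k
  have h2 : algebraMap D (Localization.AtPrime P) c ∈
      ⨅ k : ℕ, maximalIdeal (Localization.AtPrime P) ^ k := by
    rw [Ideal.mem_iInf]
    intro k
    obtain ⟨b, hb⟩ := h1 k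
    have hu : IsUnit (algebraMap D (Localization.AtPrime P) ((y ^ n) ^ k)) :=
      IsLocalization.map_units (M := P.primeCompl) _
        ⟨(y ^ n) ^ k, pow_mem (pow_mem (S := P.primeCompl) hyP n) k⟩
    rw [← Ideal.mul_unit_mem_iff_mem _ hu, ← map_mul, hb, map_mul, map_pow]
    refine Ideal.mul_mem_right _ _ (Ideal.pow_mem_pow ?_ k)
    exact (IsLocalization.AtPrime.to_map_mem_maximal_iff (Localization.AtPrime P) P _).mpr
      (hP.le (Ideal.mem_span_singleton_self _))
  rw [Ideal.iInf_pow_eq_bot_of_isLocalRing _ (maximalIdeal.isMaximal _).ne_top,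
    Ideal.mem_bot] at h2
  exact hc0 ((IsLocalization.to_map_eq_zero_iff _ P.primeCompl_le_nonZeroDivisors).mp h2)

theorem Ideal.ringKrullDim_quotient_add_one_of_height_eq_one (P : Ideal D) [P.IsPrime]
    (hP : P.height = 1) : ringKrullDim (D ⧸ P) + 1 = ringKrullDim D := by
  obtain ⟨Λ, π, h⟩ := exists_isCoefficientRing D
  have hPm : P ≤ maximalIdeal D := le_maximalIdeal (Ideal.IsPrime.ne_top inferInstance)
  have hnat (I : Ideal D) (hI : I ≤ maximalIdeal D) : ∃ n : ℕ, ringKrullDim (D ⧸ I) = n := by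
    have hI1 : I ≠ ⊤ := fun h ↦ (maximalIdeal.isMaximal D).ne_top (top_le_iff.mp (h ▸ hI))
    have := Ideal.Quotient.nontrivial_iff.mpr hI1
    have : IsLocalRing (D ⧸ I) := .of_surjective' _ Ideal.Quotient.mk_surjective
    rw [← IsLocalRing.maximalIdeal_height_eq_ringKrullDim]
    obtain ⟨n, hn⟩ := ENat.ne_top_iff_exists.mp
      (Ideal.height_ne_top (I := maximalIdeal (D ⧸ I)) (maximalIdeal.isMaximal _).ne_top)
    exact ⟨n, by rw [← hn]; rfl⟩
  have hbot : ringKrullDim (D ⧸ (⊥ : Ideal D)) = ringKrullDim D :=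
    ringKrullDim_eq_of_ringEquiv (RingEquiv.quotientBot D)
  obtain ⟨d, hd⟩ := hnat ⊥ bot_le
  obtain ⟨e, he⟩ := hnat P hPm
  have hdrop {x : D} (hx : x ≠ 0) {J : Ideal D} (hJ : x ∈ J) :
      ringKrullDim (D ⧸ J) + 1 ≤ d :=
    hd ▸ Ideal.ringKrullDim_quotient_add_one_le (q := ⊥) bot_le hJ (by simpa using hx)
  have hd' : ringKrullDim D = d := hbot ▸ hd
  have hP0 : P ≠ ⊥ := by
    rintro rfl
    simp at hP
  obtain ⟨x₀, hx₀P, hx₀⟩ := P.ne_bot_iff.mp hP0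
  have hle := hdrop hx₀ hx₀P
  rw [he] at hle
  rw [he, hd']
  norm_cast at hle ⊢
  by_contra hne
  have hs (x : D) (hxP : x ∈ P) : ∀ q ∈ {q | q ∈ (Ideal.span {x}).minimalPrimes ∧ q ≠ P},
      q.IsPrime ∧ ¬ P ≤ q := fun q hq ↦ ⟨hq.1.isPrime, fun hPq ↦ hq.2 (le_antisymm (hq.1.2
    ⟨inferInstance, (Ideal.span_singleton_le_iff_mem _).mpr hxP⟩ hPq) hPq)⟩
  have hsf (x : D) : {q | q ∈ (Ideal.span {x}).minimalPrimes ∧ q ≠ P}.Finite :=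
    ((Ideal.span {x}).finite_minimalPrimes_of_isNoetherianRing D).subset fun q hq ↦ hq.1
  by_cases hπP : (π : D) ∈ P
  · obtain ⟨n, rfl⟩ : ∃ n, d = n + 2 := ⟨d - 2, by omega⟩
    obtain ⟨x, hxP, hx0, hπx⟩ : ∃ x ∈ P, x ≠ 0 ∧ (π = 0 ∨ x = π) := by
      by_cases hπ : π = 0
      · exact ⟨x₀, hx₀P, hx₀, .inl hπ⟩
      · exact ⟨π, hπP, by simpa using hπ, .inr rfl⟩
    obtain ⟨z, hzP, hz, hdim⟩ := Ideal.exists_mem_ringKrullDim_quotient_sup_le (n := n)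
      (hsf x) (hs x hxP) (WithBot.le_of_add_one_le (hdrop hx0 (Ideal.mem_span_singleton_self x)))
      (by
        rw [sup_eq_right.mpr ((Ideal.span_singleton_le_iff_mem _).mpr hxP), he]
        norm_cast
        omega)
    obtain ⟨l, N, hl, hlen, hN⟩ := IsLocalRing.exists_list_maximalIdeal_pow_le (sup_le
      ((Ideal.span_singleton_le_iff_mem _).mpr (hPm hxP))
      ((Ideal.span_singleton_le_iff_mem _).mpr (hPm hzP))) hdim
    have hmin := Ideal.mem_minimalPrimes_span_of_height_eq_one hP hxP hx0
    by_cases hπ : π = 0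
    · subst hπ
      refine h.false_of_parameters hx0 hmin hzP (fun q hq hqP ↦ hz q ⟨hq, hqP⟩) (l := x :: l)
        (by simpa using ⟨hPm hxP, hl⟩) (.inr (by simp)) (hN.trans ?_) hd' ?_
      · refine sup_le (sup_le ?_ ?_) ?_
        · exact le_sup_of_le_right (Ideal.span_mono (by simp))
        · exact le_sup_of_le_left le_sup_right
        · exact le_sup_of_le_right (Ideal.span_mono fun a ha ↦ List.mem_cons_of_mem _ ha)
      · rw [h.ringKrullDim_eq_zero, List.length_cons, hlen]
        norm_cast
        omega
    · obtain rfl := hπx.resolve_left hπ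
      refine h.false_of_parameters hx0 hmin hzP (fun q hq hqP ↦ hz q ⟨hq, hqP⟩) hl (.inl rfl)
        hN hd' ?_
      rw [h.ringKrullDim_eq_one hπ, hlen]
      norm_cast
      omega
  · have hπ : (π : D) ≠ 0 := fun h0 ↦ hπP (h0 ▸ zero_mem P)
    have hJm : Ideal.span {(π : D)} ⊔ P ≤ maximalIdeal D :=
      sup_le ((Ideal.span_singleton_le_iff_mem _).mpr h.mem) hPm
    obtain ⟨f, hf⟩ := hnat _ hJm
    have hfe := Ideal.ringKrullDim_quotient_add_one_le (le_sup_right (a := Ideal.span {(π : D)}))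
      (Ideal.mem_sup_left (Ideal.mem_span_singleton_self _)) hπP
    rw [hf, he] at hfe
    norm_cast at hfe
    obtain ⟨n, rfl⟩ : ∃ n, d = n + 3 := ⟨d - 3, by omega⟩
    obtain ⟨x, hxP, hx, hdimx⟩ := Ideal.exists_mem_ringKrullDim_quotient_sup_le (n := n + 1)
      (Set.finite_singleton (⊥ : Ideal D)) (P := P) (J := Ideal.span {(π : D)})
      (by
        rintro q rfl
        exact ⟨inferInstance, by rwa [le_bot_iff]⟩)
      (WithBot.le_of_add_one_le (hdrop hπ (Ideal.mem_span_singleton_self _)))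
      (by
        rw [hf]
        norm_cast
        omega)
    have hx0 : x ≠ 0 := by simpa using hx ⊥ rfl
    obtain ⟨z, hzP, hz, hdim⟩ := Ideal.exists_mem_ringKrullDim_quotient_sup_le (n := n)
      (hsf x) (hs x hxP) hdimx (by
        rw [sup_assoc, sup_eq_right.mpr ((Ideal.span_singleton_le_iff_mem _).mpr hxP), hf]
        norm_cast
        omega)
    obtain ⟨l, N, hl, hlen, hN⟩ := IsLocalRing.exists_list_maximalIdeal_pow_le (sup_le
      (sup_le ((Ideal.span_singleton_le_iff_mem _).mpr h.mem)
        ((Ideal.span_singleton_le_iff_mem _).mpr (hPm hxP)))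
      ((Ideal.span_singleton_le_iff_mem _).mpr (hPm hzP))) hdim
    refine h.false_of_parameters hx0
      (Ideal.mem_minimalPrimes_span_of_height_eq_one hP hxP hx0) hzP
      (fun q hq hqP ↦ hz q ⟨hq, hqP⟩) (l := x :: l)
      (by simpa using ⟨hPm hxP, hl⟩) (.inr (by simp)) (hN.trans ?_) hd' ?_
    · refine sup_le (sup_le (sup_le ?_ ?_) ?_) ?_
      · exact le_sup_of_le_left le_sup_left
      · exact le_sup_of_le_right (Ideal.span_mono (by simp))
      · exact le_sup_of_le_left le_sup_right
      · exact le_sup_of_le_right (Ideal.span_mono fun a ha ↦ List.mem_cons_of_mem _ ha)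
    · rw [h.ringKrullDim_eq_one (fun h0 ↦ hπ (by rw [h0]; rfl)), List.length_cons, hlen]
      norm_cast
      omega

end HeightOne

/-- Among the primes contained in `M`, the height increases by exactly one along every covering
relation. -/
def PrimeSpectrum.HeightGradedBelow {R : Type} [CommRing R] (M : PrimeSpectrum R) : Prop :=
  ∀ Q Q' : PrimeSpectrum R, Q' ≤ M → Q ⋖ Q' → Q'.asIdeal.height = Q.asIdeal.height + 1

theorem Ideal.map_quotientMk_lt_map_quotientMk {R : Type} [CommRing R] {N K L : Ideal R}
    (hNK : N ≤ K) (hKL : K < L) :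
    K.map (Ideal.Quotient.mk N) < L.map (Ideal.Quotient.mk N) := by
  refine lt_of_le_of_ne (Ideal.map_mono hKL.le) fun h ↦ hKL.ne ?_
  have := congrArg (Ideal.comap (Ideal.Quotient.mk N)) h
  rwa [Ideal.comap_map_mk hNK, Ideal.comap_map_mk (hNK.trans hKL.le)] at this

theorem Ideal.comap_quotientMk_lt_comap_quotientMk {R : Type} [CommRing R] {N : Ideal R}
    {K L : Ideal (R ⧸ N)} (hKL : K < L) :
    K.comap (Ideal.Quotient.mk N) < L.comap (Ideal.Quotient.mk N) :=
  (Ideal.comap_mono hKL.le).lt_of_ne fun h ↦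
    hKL.ne (Ideal.comap_injective_of_surjective _ Ideal.Quotient.mk_surjective h)

theorem Ideal.false_of_height_map_mk_le_one {R : Type} [CommRing R]
    {N K N' : Ideal R} [N.IsPrime] [K.IsPrime] [N'.IsPrime]
    (h : (N'.map (Ideal.Quotient.mk N)).height ≤ 1) (hNK : N < K) (hKN' : K < N') : False := by
  have hp (L : Ideal R) [L.IsPrime] (hL : N ≤ L) : (L.map (Ideal.Quotient.mk N)).IsPrime :=
    Ideal.map_isPrime_of_surjective Ideal.Quotient.mk_surjective (by rwa [Ideal.mk_ker])
  have := hp K hNK.le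
  have := hp N' (hNK.trans hKN').le
  have h1 := Ideal.map_quotientMk_lt_map_quotientMk hNK.le hKN'
  have h2 := Ideal.height_add_one_le_of_lt_of_isPrime h1
  have h3 : (K.map (Ideal.Quotient.mk N)).height ≠ 0 := fun h0 ↦ by
    rw [Ideal.height_eq_zero_iff_eq_bot,
        Ideal.map_eq_bot_iff_le_ker, Ideal.mk_ker] at h0
    exact hNK.not_ge h0
  have h5 := (add_le_add_left (Order.one_le_iff_ne_zero.mpr h3) 1).trans (h2.trans h)
  exact absurd h5 (by decide)

namespace PrimeSpectrum

variable {R S : Type} [CommRing R] [CommRing S]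

theorem HeightGradedBelow.mono {M N : PrimeSpectrum R} (h : M.HeightGradedBelow) (hNM : N ≤ M) :
    N.HeightGradedBelow := fun Q Q' hQ' hQ ↦ h Q Q' (hQ'.trans hNM) hQ

theorem height_eq_add_of_isSaturatedChain (h : ∀ M : PrimeSpectrum R, M.HeightGradedBelow)
    {n : ℕ} {f : Fin (n + 1) → PrimeSpectrum R} (hf : IsSaturatedChain f) (i : Fin (n + 1)) :
    (f i).asIdeal.height = (f 0).asIdeal.height + (i : ℕ) := by
  induction i using Fin.induction with
  | zero => simp
  | succ i ih =>
    rw [h _ _ _ le_rfl (hf i), ih, Fin.val_castSucc, Fin.val_succ, add_assoc]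
    norm_cast

theorem isCatenary_of_heightGradedBelow [IsNoetherianRing R]
    (h : ∀ M : PrimeSpectrum R, M.HeightGradedBelow) : IsCatenary R := by
  intro n m f g hf hg h0 hlast
  have h1 := height_eq_add_of_isSaturatedChain h hf (Fin.last n)
  rw [hlast, height_eq_add_of_isSaturatedChain h hg (Fin.last m), h0] at h1
  have h2 := (ENat.add_left_injective_of_ne_top
    (Ideal.height_ne_top (g 0).isPrime.ne_top)) ((add_comm _ _).trans (h1.trans (add_comm _ _)))
  simpa using (Nat.cast_inj.mp h2).symm

theorem HeightGradedBelow.of_isLocalization [Algebra R S] (T : Submonoid R) [IsLocalization T S]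
    {M : PrimeSpectrum S} (h : (comap (algebraMap R S) M).HeightGradedBelow) :
    M.HeightGradedBelow := by
  intro Q Q' hQ' hQ
  have h1 := h (comap (algebraMap R S) Q) (comap (algebraMap R S) Q')
    (Ideal.comap_mono hQ') ⟨⟨Ideal.comap_mono hQ.le, fun hle ↦ ?_⟩, fun K hK hK' ↦ ?_⟩
  · have h2 (q : PrimeSpectrum S) := IsLocalization.height_under T q.asIdeal
    rw [← h2, ← h2]
    exact h1
  · exact hQ.lt.not_ge ((IsLocalization.orderEmbedding T S).le_iff_le.mp hle)
  · have hdisj : Disjoint (T : Set R) K.asIdeal :=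
      ((IsLocalization.isPrime_iff_isPrime_disjoint T S Q'.asIdeal).mp Q'.isPrime).2.mono_right
        hK'.le
    have hKp := IsLocalization.isPrime_of_isPrime_disjoint T S K.asIdeal K.isPrime hdisj
    have hKu := IsLocalization.under_map_of_isPrime_disjoint T S K.isPrime hdisj
    refine hQ.2 (c := ⟨K.asIdeal.map (algebraMap R S), hKp⟩)
      ((IsLocalization.orderEmbedding T S).lt_iff_lt (a := Q.asIdeal) (b := K.asIdeal.map _)
        |>.mp ?_)
      ((IsLocalization.orderEmbedding T S).lt_iff_lt (a := K.asIdeal.map _) (b := Q'.asIdeal)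
        |>.mp ?_)
    · exact lt_of_lt_of_eq hK hKu.symm
    · exact lt_of_eq_of_lt hKu hK'

theorem HeightGradedBelow.of_flat [IsNoetherianRing R] [IsNoetherianRing S] {f : R →+* S}
    (hf : f.Flat) {M : PrimeSpectrum S} (h : M.HeightGradedBelow) :
    (comap f M).HeightGradedBelow := by
  let := f.toAlgebra
  have : Module.Flat R S := hf
  have hmin (q : Ideal R) (M : Ideal S) [q.IsPrime] [M.IsPrime] (hq : q ≤ M.under R) :
      ∃ N ≤ M, N.IsPrime ∧ N.LiesOver q ∧ N ∈ (q.map f).minimalPrimes ∧ N.height = q.height := by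
    have : M.LiesOver (M.under R) := ⟨rfl⟩
    obtain ⟨N₀, hN₀M, hN₀, hN₀q⟩ := Ideal.exists_ideal_le_liesOver_of_le M hq
    obtain ⟨N, hN, hNN₀⟩ := Ideal.exists_minimalPrimes_le
      (Ideal.map_le_iff_le_comap.mpr hN₀q.over.le)
    have hNp := hN.isPrime
    have hover : N.LiesOver q := ⟨le_antisymm (Ideal.map_le_iff_le_comap.mp hN.le)
      ((Ideal.comap_mono hNN₀).trans hN₀q.over.ge)⟩
    refine ⟨N, hNN₀.trans hN₀M, hNp, hover, hN, ?_⟩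
    rw [Ideal.height_eq_height_add_of_liesOver_of_hasGoingDown q N]
    have hp : (N.map (Ideal.Quotient.mk (q.map (algebraMap R S)))).IsPrime :=
      Ideal.map_isPrime_of_surjective Ideal.Quotient.mk_surjective
        (by rw [Ideal.mk_ker]; exact hN.le)
    suffices (N.map (Ideal.Quotient.mk (q.map (algebraMap R S)))).height = 0 by
      rw [this, add_zero]
    rw [Ideal.height_eq_zero_iff]
    change _ ∈ (⊥ : Ideal _).minimalPrimes
    rw [← Ideal.map_bot (f := Ideal.Quotient.mk (q.map (algebraMap R S))),
      Ideal.minimalPrimes_map_of_surjective Ideal.Quotient.mk_surjective, bot_sup_eq, Ideal.mk_ker]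
    exact ⟨N, hN, rfl⟩
  intro Q Q' hQ' hQ
  obtain ⟨N', hN'M, _, hN'Q, hN', hN'h⟩ := hmin Q'.asIdeal M.asIdeal hQ'
  obtain ⟨N, hNN', _, hNQ, hN, hNh⟩ := hmin Q.asIdeal N' (LE.le.trans hQ.le hN'Q.over.le)
  rw [← hN'h, ← hNh]
  refine h ⟨N, inferInstance⟩ ⟨N', inferInstance⟩ hN'M ⟨?_, fun K hNK hKN' ↦ ?_⟩
  · refine lt_of_le_of_ne hNN' fun h ↦ hQ.ne (PrimeSpectrum.ext ?_)
    rw [hNQ.over, hN'Q.over, show N = N' from congr($(h).asIdeal)]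
  · obtain ⟨b, hbQ', hbQ⟩ := SetLike.exists_of_lt (show Q.asIdeal < Q'.asIdeal from hQ.lt)
    have hmin' : N' ∈ (N ⊔ Ideal.span {f b}).minimalPrimes := by
      refine ⟨⟨inferInstance, sup_le hNN' ((Ideal.span_singleton_le_iff_mem _).mpr ?_)⟩,
        fun L ⟨hL, hNL⟩ hLN' ↦ ?_⟩
      · exact hN'Q.over.le hbQ'
      · refine hN'.2 ⟨hL, Ideal.map_le_iff_le_comap.mpr ?_⟩ hLN'
        have hbL : f b ∈ L := hNL (Ideal.mem_sup_right (Ideal.mem_span_singleton_self _))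
        have h1 : Q < comap f ⟨L, hL⟩ := lt_of_le_of_ne
          (hNQ.over.le.trans (Ideal.comap_mono (le_sup_left.trans hNL)))
          fun h ↦ hbQ (h.ge hbL)
        have h2 : comap f ⟨L, hL⟩ ≤ Q' := (Ideal.comap_mono hLN').trans hN'Q.over.ge
        exact (h2.eq_of_not_lt (hQ.2 h1)).ge
    exact Ideal.false_of_height_map_mk_le_one
      (Ideal.map_height_le_one_of_mem_minimalPrimes hmin') (K := K.asIdeal) hNK hKN'

end PrimeSpectrum

section

variable {R : Type} [CommRing R] [IsLocalRing R] [IsNoetherianRing R]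

theorem IsAdicComplete.quotient_maximalIdeal [IsAdicComplete (maximalIdeal R) R] (Q : Ideal R)
    [IsLocalRing (R ⧸ Q)] : IsAdicComplete (maximalIdeal (R ⧸ Q)) (R ⧸ Q) := by
  have h1 : IsPrecomplete (maximalIdeal R) (R ⧸ Q) := by
    rw [← AdicCompletion.of_surjective_iff]
    intro y
    obtain ⟨x, rfl⟩ := AdicCompletion.map_surjective (maximalIdeal R) (f := Q.mkQ)
      Q.mkQ_surjective y
    obtain ⟨x, rfl⟩ := AdicCompletion.of_surjective (maximalIdeal R) R x
    exact ⟨Q.mkQ x, (AdicCompletion.map_of (maximalIdeal R) Q.mkQ x).symm⟩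
  have h2 : (maximalIdeal R).map (algebraMap R (R ⧸ Q)) = maximalIdeal (R ⧸ Q) :=
    IsLocalRing.map_maximalIdeal_of_surjective _ Ideal.Quotient.mk_surjective
  have := IsPrecomplete.map_algebraMap_iff (I := maximalIdeal R) (S := R ⧸ Q) (M := R ⧸ Q)
  rw [h2] at this
  have := this.mpr h1
  exact {}

theorem Ideal.ringKrullDim_quotient_add_one_of_covBy [IsAdicComplete (maximalIdeal R) R]
    {Q Q' : PrimeSpectrum R} (h : Q ⋖ Q') :
    ringKrullDim (R ⧸ Q'.asIdeal) + 1 = ringKrullDim (R ⧸ Q.asIdeal) := by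
  have : IsLocalRing (R ⧸ Q.asIdeal) := .of_surjective' _ Ideal.Quotient.mk_surjective
  have := IsAdicComplete.quotient_maximalIdeal Q.asIdeal
  have hk : RingHom.ker (Ideal.Quotient.mk Q.asIdeal) ≤ Q'.asIdeal := by
    rw [Ideal.mk_ker]; exact h.le
  have : (Q'.asIdeal.map (Ideal.Quotient.mk Q.asIdeal)).IsPrime :=
    Ideal.map_isPrime_of_surjective Ideal.Quotient.mk_surjective hk
  have h1 : (Q'.asIdeal.map (Ideal.Quotient.mk Q.asIdeal)).height = 1 := by
    refine le_antisymm (Ideal.height_le_iff_covBy.mpr fun q hq hqQ' _ ↦ ?_) ?_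
    · have hq0 : q = ⊥ := by
        by_contra hq0
        refine h.2 (c := ⟨q.comap (Ideal.Quotient.mk Q.asIdeal), hq.comap _⟩) ?_ ?_
        · have h3 := Ideal.comap_quotientMk_lt_comap_quotientMk (bot_lt_iff_ne_bot.mpr hq0)
          rwa [← RingHom.ker_eq_comap_bot, Ideal.mk_ker] at h3
        · have h3 := Ideal.comap_quotientMk_lt_comap_quotientMk hqQ'
          rwa [Ideal.comap_map_mk h.le] at h3
      subst hq0
      rw [Ideal.height_bot]
      exact zero_lt_one
    · rw [Order.one_le_iff_ne_zero, Ne, Ideal.height_eq_zero_iff_eq_bot,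
        Ideal.map_eq_bot_iff_le_ker, Ideal.mk_ker]
      exact h.lt.not_ge
  rw [← Ideal.ringKrullDim_quotient_add_one_of_height_eq_one _ h1]
  congr 1
  exact ringKrullDim_eq_of_ringEquiv (DoubleQuot.quotQuotEquivQuotOfLE h.le).symm

theorem IsCompleteEquidimensional.heightGradedBelow (hR : IsCompleteEquidimensional R)
    (M : PrimeSpectrum R) : M.HeightGradedBelow := by
  have := hR.isAdicComplete
  have key (n : ℕ) : ∀ Q : PrimeSpectrum R, Q.asIdeal.height = n →
      ringKrullDim (R ⧸ Q.asIdeal) + n = ringKrullDim R := by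
    induction n with
    | zero =>
      intro Q hQ
      rw [Nat.cast_zero, Ideal.height_eq_zero_iff] at hQ
      simpa using hR.isEquidimensional _ hQ
    | succ n ih =>
      intro Q hQ
      have h1 : ¬ Q.asIdeal.height ≤ n := by
        rw [hQ]
        norm_cast
        omega
      rw [Ideal.height_le_iff_covBy] at h1
      push Not at h1
      obtain ⟨q, hq, hqQ, hcov, hqn⟩ := h1
      have h2 := Ideal.height_add_one_le_of_lt_of_isPrime hqQ
      have h3 : q.height = n := by
        refine le_antisymm ?_ hqn
        rw [hQ, Nat.cast_succ] at h2
        exact (ENat.add_le_add_iff_right ENat.one_ne_top).mp h2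
      have h4 := Ideal.ringKrullDim_quotient_add_one_of_covBy (Q := ⟨q, hq⟩) (Q' := Q)
        ⟨hqQ, fun K hK hK' ↦ hcov K.asIdeal K.isPrime hK hK'⟩
      rw [← ih ⟨q, hq⟩ h3, ← h4, Nat.cast_succ, add_assoc, add_comm (n : WithBot ℕ∞)]
  intro Q Q' _ h
  obtain ⟨a, ha⟩ := ENat.ne_top_iff_exists.mp (Ideal.height_ne_top Q.isPrime.ne_top)
  obtain ⟨b, hb⟩ := ENat.ne_top_iff_exists.mp (Ideal.height_ne_top Q'.isPrime.ne_top)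
  have : IsLocalRing (R ⧸ Q'.asIdeal) := .of_surjective' _ Ideal.Quotient.mk_surjective
  have h1 := key a Q ha.symm
  rw [← Ideal.ringKrullDim_quotient_add_one_of_covBy h, ← key b Q' hb.symm,
    ← IsLocalRing.maximalIdeal_height_eq_ringKrullDim] at h1
  obtain ⟨c, hc⟩ := ENat.ne_top_iff_exists.mp
    (Ideal.height_ne_top (I := maximalIdeal (R ⧸ Q'.asIdeal)) (maximalIdeal.isMaximal _).ne_top)
  rw [← hc] at h1
  rw [← ha, ← hb]
  norm_cast at h1 ⊢
  omega

end

theorem RingHom.Flat.polynomial_mapRingHom {R S : Type} [CommRing R] [CommRing S] {f : R →+* S}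
    (hf : f.Flat) : (Polynomial.mapRingHom f).Flat := by
  let := f.toAlgebra
  have : Module.Flat R S := hf
  let := Polynomial.algebra R S
  exact Module.Flat.isBaseChange R (Polynomial R) S (Polynomial S)
    (Algebra.IsPushout.out (R := R) (S := Polynomial R) (R' := S) (S' := Polynomial S))

theorem Polynomial.flat_coeToPowerSeries (R : Type) [CommRing R] [IsNoetherianRing R] :
    (Polynomial.coeToPowerSeries.ringHom (R := R)).Flat := by
  have h1 : (algebraMap (MvPolynomial Unit R) (MvPowerSeries Unit R)).Flat :=
    Module.Flat.of_linearEquiv (MvPowerSeries.toAdicCompletionAlgEquiv Unit R).toLinearEquiv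
  have h2 : (MvPolynomial.uniqueAlgEquiv R Unit).symm.toRingEquiv.toRingHom.Flat :=
    .of_bijective (MvPolynomial.uniqueAlgEquiv R Unit).symm.bijective
  convert! h2.comp h1 using 1
  refine Polynomial.ringHom_ext (fun a ↦ ?_) ?_
  · have h3 : (MvPolynomial.uniqueAlgEquiv R Unit).symm (Polynomial.C a) = MvPolynomial.C a :=
      Polynomial.eval₂_C _ _
    change ((Polynomial.C a : Polynomial R) : PowerSeries R) = algebraMap _ (MvPowerSeries Unit R)
      ((MvPolynomial.uniqueAlgEquiv R Unit).symm (Polynomial.C a))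
    rw [h3, Polynomial.coe_C, MvPowerSeries.algebraMap_apply', Algebra.algebraMap_self,
      MvPowerSeries.map_id, RingHom.id_apply, MvPolynomial.coe_C]
    rfl
  · have h3 : (MvPolynomial.uniqueAlgEquiv R Unit).symm Polynomial.X = MvPolynomial.X () :=
      Polynomial.eval₂_X _ _
    change ((Polynomial.X : Polynomial R) : PowerSeries R) = algebraMap _ (MvPowerSeries Unit R)
      ((MvPolynomial.uniqueAlgEquiv R Unit).symm Polynomial.X)
    rw [h3, Polynomial.coe_X, MvPowerSeries.algebraMap_apply', Algebra.algebraMap_self,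
      MvPowerSeries.map_id, RingHom.id_apply, MvPolynomial.coe_X]
    rfl

theorem MvPolynomial.constantCoeff_coeff_zero_finSuccEquiv {R : Type} [CommRing R] {n : ℕ}
    (p : MvPolynomial (Fin (n + 1)) R) :
    constantCoeff ((finSuccEquiv R n p).coeff 0) = constantCoeff p := by
  rw [constantCoeff_eq, finSuccEquiv_coeff_coeff, constantCoeff_eq]
  congr 1
  ext i
  refine Fin.cases ?_ (fun _ ↦ ?_) i <;> simp

theorem exists_flat_isCompleteEquidimensional {A : Type} [CommRing A] [IsLocalRing A]
    [IsNoetherianRing A] (h : IsEquidimensional (AdicCompletion (maximalIdeal A) A)) (n : ℕ) :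
    ∃ (R : Type) (_ : CommRing R) (_ : IsLocalRing R) (_ : IsCompleteEquidimensional R)
      (f : MvPolynomial (Fin n) A →+* R), f.Flat ∧
        ∀ p, MvPolynomial.constantCoeff p ∈ maximalIdeal A → f p ∈ maximalIdeal R := by
  induction n with
  | zero =>
    refine ⟨AdicCompletion (maximalIdeal A) A, inferInstance, inferInstance,
      ⟨inferInstance, inferInstance, h⟩, (algebraMap A _).comp
        (MvPolynomial.isEmptyAlgEquiv A (Fin 0)).toRingEquiv.toRingHom, ?_, fun p hp ↦ ?_⟩
    · exact .comp (.of_bijective (MvPolynomial.isEmptyAlgEquiv A (Fin 0)).bijective)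
        (AdicCompletion.flat_of_isNoetherian (maximalIdeal A))
    · obtain ⟨a, rfl⟩ := MvPolynomial.C_surjective (R := A) (Fin 0) p
      rw [AdicCompletion.maximalIdeal_eq_map]
      rw [MvPolynomial.constantCoeff_C] at hp
      convert Ideal.mem_map_of_mem (algebraMap A (AdicCompletion (maximalIdeal A) A)) hp using 1
      exact congrArg (algebraMap A (AdicCompletion (maximalIdeal A) A))
        ((MvPolynomial.isEmptyAlgEquiv A (Fin 0)).commutes a)
  | succ n ih =>
    obtain ⟨R, _, _, hR, f, hf, hfm⟩ := ih
    have := hR.isNoetherianRing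
    refine ⟨PowerSeries R, inferInstance, inferInstance, hR.powerSeries,
      (Polynomial.coeToPowerSeries.ringHom.comp (Polynomial.mapRingHom f)).comp
        (MvPolynomial.finSuccEquiv A n).toRingEquiv.toRingHom, ?_, fun p hp ↦ ?_⟩
    · exact .comp (.of_bijective (MvPolynomial.finSuccEquiv A n).bijective)
        (.comp hf.polynomial_mapRingHom (Polynomial.flat_coeToPowerSeries R))
    · rw [mem_maximalIdeal, mem_nonunits_iff, PowerSeries.isUnit_iff_constantCoeff]
      have h1 := hfm ((MvPolynomial.finSuccEquiv A n p).coeff 0)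
        (by rwa [MvPolynomial.constantCoeff_coeff_zero_finSuccEquiv])
      convert (mem_nonunits_iff.1 ((mem_maximalIdeal _).1 h1)) using 2
      change PowerSeries.constantCoeff
        (((MvPolynomial.finSuccEquiv A n p).map f : Polynomial R) : PowerSeries R) = _
      rw [Polynomial.constantCoeff_coe, Polynomial.coeff_map]

theorem LaurentPolynomial.ringHom_ext {R S : Type} [CommRing R] [CommRing S]
    {f g : LaurentPolynomial R →+* S} (hC : f.comp C = g.comp C) (hT : f (T 1) = g (T 1)) :
    f = g := by
  refine IsLocalization.ringHom_ext (.powers (Polynomial.X : Polynomial R))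
    (Polynomial.ringHom_ext (fun a ↦ ?_) ?_)
  · simpa [algebraMap_eq_toLaurent] using congr($hC a)
  · simpa [algebraMap_eq_toLaurent] using hT

theorem exists_injective_ringHom_field (R : Type) [CommRing R] [IsDomain R] :
    ∃ (K : Type) (_ : Field K) (f : R →+* K), Function.Injective f :=
  ⟨FractionRing R, inferInstance, algebraMap R (FractionRing R), IsFractionRing.injective _ _⟩

theorem LaurentPolynomial.flat_C (R : Type) [CommRing R] : (C (R := R)).Flat := by
  have h : C (R := R) = (algebraMap (Polynomial R) (LaurentPolynomial R)).comp
      (algebraMap R (Polynomial R)) :=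
    RingHom.ext fun r ↦ by simp [algebraMap_eq_toLaurent]
  rw [h]
  exact .comp (RingHom.flat_algebraMap_iff.2 inferInstance)
    (RingHom.flat_algebraMap_iff.2 (IsLocalization.flat _ (.powers (Polynomial.X : Polynomial R))))

/-- Every prime of `A[x₁, …, xₙ]` is the contraction, under a flat map to the ring of Laurent
polynomials, of a prime whose polynomial elements have no unit constant term. -/
theorem PrimeSpectrum.exists_laurentPolynomial_comap {A : Type} [CommRing A] {n : ℕ}
    (Q : PrimeSpectrum (MvPolynomial (Fin n) A)) :
    ∃ (M : PrimeSpectrum (LaurentPolynomial (MvPolynomial (Fin n) A)))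
      (f : MvPolynomial (Fin n) A →+* LaurentPolynomial (MvPolynomial (Fin n) A)),
      f.Flat ∧ comap f M = Q ∧
        ∀ p ∈ (comap (algebraMap (Polynomial (MvPolynomial (Fin n) A)) _) M).asIdeal,
          ¬ IsUnit (MvPolynomial.constantCoeff (p.coeff 0)) := by
  let t : (LaurentPolynomial (MvPolynomial (Fin n) A))ˣ := (LaurentPolynomial.isUnit_T 1).unit
  have ht : (t : LaurentPolynomial (MvPolynomial (Fin n) A)) = .T 1 := rfl
  let g (u : (LaurentPolynomial (MvPolynomial (Fin n) A))ˣ) :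
      LaurentPolynomial (MvPolynomial (Fin n) A) →+* LaurentPolynomial (MvPolynomial (Fin n) A) :=
    LaurentPolynomial.eval₂ (MvPolynomial.eval₂Hom (LaurentPolynomial.C.comp MvPolynomial.C)
      fun i ↦ LaurentPolynomial.C (MvPolynomial.X i : MvPolynomial (Fin n) A) * u) t
  have hgT (u : (LaurentPolynomial (MvPolynomial (Fin n) A))ˣ) : g u t = t := by
    rw [ht, LaurentPolynomial.eval₂_T, zpow_one, ht]
  have hgt (u : (LaurentPolynomial (MvPolynomial (Fin n) A))ˣ) :
      g u (t⁻¹ : (LaurentPolynomial (MvPolynomial (Fin n) A))ˣ) =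
      (t⁻¹ : (LaurentPolynomial (MvPolynomial (Fin n) A))ˣ) := by
    have : Units.map (g u).toMonoidHom t = t :=
      Units.ext (hgT u)
    conv_rhs => rw [← this]
    rfl
  have hgC (u : (LaurentPolynomial (MvPolynomial (Fin n) A))ˣ) (a : A) :
      g u (LaurentPolynomial.C (MvPolynomial.C a)) = LaurentPolynomial.C (MvPolynomial.C a) := by
    rw [LaurentPolynomial.eval₂_C, MvPolynomial.coe_eval₂Hom, MvPolynomial.eval₂_C]
    rfl
  have hgX (u : (LaurentPolynomial (MvPolynomial (Fin n) A))ˣ) (i : Fin n) :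
      g u (LaurentPolynomial.C (MvPolynomial.X i : MvPolynomial (Fin n) A)) =
        LaurentPolynomial.C (MvPolynomial.X i : MvPolynomial (Fin n) A) * u := by
    rw [LaurentPolynomial.eval₂_C, MvPolynomial.coe_eval₂Hom, MvPolynomial.eval₂_X]
  have hg (u v : (LaurentPolynomial (MvPolynomial (Fin n) A))ˣ) (hgv : g v u = u)
      (huv : v * u = 1) :
      (g v).comp (g u) = RingHom.id _ := by
    refine LaurentPolynomial.ringHom_ext (MvPolynomial.ringHom_ext (fun a ↦ ?_) fun i ↦ ?_) ?_
    · simp only [RingHom.comp_apply, hgC, RingHom.id_apply]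
    · simp only [RingHom.comp_apply, hgX, map_mul, hgv, mul_assoc, ← Units.val_mul, huv,
        Units.val_one, mul_one, RingHom.id_apply]
    · rw [← ht, RingHom.comp_apply, hgT, hgT, RingHom.id_apply]
  have h1 : (g t).comp (g t⁻¹) = RingHom.id _ := hg t⁻¹ t (hgt t) (mul_inv_cancel t)
  have h2 : (g t⁻¹).comp (g t) = RingHom.id _ := hg t t⁻¹ (hgT t⁻¹) (inv_mul_cancel t)
  obtain ⟨K, _, ι, hι⟩ :=
    exists_injective_ringHom_field (Polynomial (MvPolynomial (Fin n) A ⧸ Q.asIdeal))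
  let x : Kˣ := Units.mk0 (ι .X) ((map_ne_zero_iff _ hι).2 Polynomial.X_ne_zero)
  let χ : LaurentPolynomial (MvPolynomial (Fin n) A) →+* K :=
    LaurentPolynomial.eval₂ ((ι.comp Polynomial.C).comp (Ideal.Quotient.mk Q.asIdeal)) x
  refine ⟨⟨RingHom.ker (χ.comp (g t)), RingHom.ker_isPrime _⟩,
    (g t⁻¹).comp LaurentPolynomial.C, ?_, ?_, fun p hp hu ↦ ?_⟩
  · exact (LaurentPolynomial.flat_C _).comp (.of_bijective (Function.bijective_iff_has_inverse.2
      ⟨g t, fun y ↦ congr($h1 y), fun y ↦ congr($h2 y)⟩))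
  · ext b
    change χ ((g t).comp (g t⁻¹) (LaurentPolynomial.C b)) = 0 ↔ _
    rw [h1, RingHom.id_apply, LaurentPolynomial.eval₂_C]
    simp only [RingHom.comp_apply]
    rw [map_eq_zero_iff _ hι, map_eq_zero_iff _ Polynomial.C_injective,
      Ideal.Quotient.eq_zero_iff_mem]
  · let φ : Polynomial (MvPolynomial (Fin n) A) →+* Polynomial (MvPolynomial (Fin n) A) :=
      Polynomial.eval₂RingHom
      (MvPolynomial.eval₂Hom (Polynomial.C.comp MvPolynomial.C)
        fun i ↦ Polynomial.C (MvPolynomial.X i) * Polynomial.X) Polynomial.X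
    have h4 : (χ.comp (g t)).comp (algebraMap (Polynomial (MvPolynomial (Fin n) A))
        (LaurentPolynomial (MvPolynomial (Fin n) A))) =
        (ι.comp (Polynomial.mapRingHom (Ideal.Quotient.mk Q.asIdeal))).comp φ := by
      refine Polynomial.ringHom_ext' (MvPolynomial.ringHom_ext (fun a ↦ ?_) fun i ↦ ?_) ?_
      · simp only [RingHom.comp_apply, LaurentPolynomial.algebraMap_eq_toLaurent,
          Polynomial.toLaurent_C, hgC]
        rw [LaurentPolynomial.eval₂_C]
        simp [φ, RingHom.comp_apply]
      · simp only [RingHom.comp_apply, LaurentPolynomial.algebraMap_eq_toLaurent,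
          Polynomial.toLaurent_C, hgX, map_mul, ht]
        rw [LaurentPolynomial.eval₂_C, LaurentPolynomial.eval₂_T]
        simp [φ, x, RingHom.comp_apply]
      · simp only [RingHom.comp_apply, LaurentPolynomial.algebraMap_eq_toLaurent,
          Polynomial.toLaurent_X]
        rw [← ht, hgT, ht, LaurentPolynomial.eval₂_T]
        simp [φ, x]
    have h5 : Polynomial.constantCoeff.comp φ =
        (MvPolynomial.C.comp MvPolynomial.constantCoeff).comp Polynomial.constantCoeff := by
      refine Polynomial.ringHom_ext' (MvPolynomial.ringHom_ext (fun a ↦ ?_) fun i ↦ ?_) ?_ <;>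
        simp [φ]
    have h6 : ι (Polynomial.mapRingHom (Ideal.Quotient.mk Q.asIdeal) (φ p)) = 0 :=
      (congr($h4 p)).symm.trans hp
    rw [map_eq_zero_iff _ hι] at h6
    have h7 : Ideal.Quotient.mk Q.asIdeal
        (MvPolynomial.C (MvPolynomial.constantCoeff (p.coeff 0))) = 0 := by
      have h8 := congr(($h6).coeff 0)
      rw [Polynomial.coe_mapRingHom, Polynomial.coeff_map, Polynomial.coeff_zero] at h8
      rw [← h8]
      exact congrArg _ (congr($h5 p)).symm
    exact Q.isPrime.ne_top (Ideal.eq_top_of_isUnit_mem _ (Ideal.Quotient.eq_zero_iff_mem.1 h7)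
      (hu.map MvPolynomial.C))

theorem isUniversallyCatenary_of_isEquidimensional_adicCompletion {A : Type} [CommRing A]
    [IsLocalRing A] [IsNoetherianRing A]
    (h : IsEquidimensional (AdicCompletion (maximalIdeal A) A)) : IsUniversallyCatenary A := by
  intro n
  refine PrimeSpectrum.isCatenary_of_heightGradedBelow fun Q ↦ ?_
  obtain ⟨R, _, _, hR, f, hf, hfm⟩ := exists_flat_isCompleteEquidimensional h (n + 1)
  have := hR.isNoetherianRing
  obtain ⟨M, g, hg, rfl, hM⟩ := Q.exists_laurentPolynomial_comap
  have : IsNoetherianRing (LaurentPolynomial (MvPolynomial (Fin n) A)) :=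
    IsLocalization.isNoetherianRing (.powers (Polynomial.X : Polynomial (MvPolynomial (Fin n) A))) _
      inferInstance
  refine .of_flat hg
    (.of_isLocalization (.powers (Polynomial.X : Polynomial (MvPolynomial (Fin n) A))) ?_)
  have hf' : (f.comp (MvPolynomial.finSuccEquiv A n).symm.toRingEquiv.toRingHom).Flat :=
    .comp (.of_bijective (MvPolynomial.finSuccEquiv A n).symm.bijective) hf
  refine (PrimeSpectrum.HeightGradedBelow.of_flat hf'
    (hR.heightGradedBelow ⟨maximalIdeal R, inferInstance⟩)).mono ?_
  intro p hp
  refine hfm _ ?_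
  have := hM p hp
  rw [mem_maximalIdeal, mem_nonunits_iff, ← MvPolynomial.constantCoeff_coeff_zero_finSuccEquiv]
  convert this
  exact (MvPolynomial.finSuccEquiv A n).apply_symm_apply p

/-- If the completion `Â` of a Noetherian local ring `A` is equidimensional, then `A` is
universally catenary; consequently, if `A` is a Noetherian local domain that is not
universally catenary, then `Â` is not equidimensional. -/
theorem stmt17 (A : Type) [CommRing A] [IsLocalRing A] [IsNoetherianRing A] :
    (IsEquidimensional (AdicCompletion (maximalIdeal A) A) → IsUniversallyCatenary A) ∧
    (IsDomain A → ¬ IsUniversallyCatenary A →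
      ¬ IsEquidimensional (AdicCompletion (maximalIdeal A) A)) := by
  refine ⟨isUniversallyCatenary_of_isEquidimensional_adicCompletion, fun _ h h' ↦ h ?_⟩
  exact isUniversallyCatenary_of_isEquidimensional_adicCompletion h'
end

section
/- Let T = K⟦x, y₁, ..., y_a, z₁, ..., z_b⟧/((x) ∩ (y₁,...,y_a)) where K is a field and a, b > 1. Then: the associated primes of T are exactly the images of (x) and (y₁,...,y_a); dim T = a + b; dim(T/(y₁,...,y_a)) = b + 1 < a + b; and depth T > 1. -/
open IsLocalRing

/-- The depth of a local ring: the supremum of lengths of regular sequences contained in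
the maximal ideal. -/
noncomputable def ringDepth (R : Type) [CommRing R] [IsLocalRing R] : ℕ∞ :=
  sSup {n : ℕ∞ | ∃ rs : List R, (rs.length : ℕ∞) = n ∧
    (∀ r ∈ rs, r ∈ maximalIdeal R) ∧ RingTheory.Sequence.IsRegular R rs}

/-- The index type for the variables `x`, `y₁, …, y_a`, `z₁, …, z_b`. -/
abbrev Var (a b : ℕ) : Type := Unit ⊕ (Fin a ⊕ Fin b)

/-- The ideal `(x) ∩ (y₁, …, y_a)` in `K⟦x, y₁, …, y_a, z₁, …, z_b⟧`. -/
noncomputable def exIdeal (K : Type) [Field K] (a b : ℕ) :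
    Ideal (MvPowerSeries (Var a b) K) :=
  Ideal.span {MvPowerSeries.X (Sum.inl ())} ⊓
    Ideal.span (Set.range fun i : Fin a => MvPowerSeries.X (Sum.inr (Sum.inl i)))

/-- `T = K⟦x, y₁, …, y_a, z₁, …, z_b⟧/((x) ∩ (y₁, …, y_a))`. -/
abbrev exRing (K : Type) [Field K] (a b : ℕ) : Type :=
  MvPowerSeries (Var a b) K ⧸ exIdeal K a b

/-- If the element `t` lies in the ideal `Q` but not in the prime `P`, then the annihilator of `t`
in `R ⧸ P ⊓ Q` is the image of `P`. -/
lemma Ideal.colon_bot_mk_inf {R : Type*} [CommRing R] {P Q : Ideal R} [P.IsPrime] {t : R}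
    (hP : t ∉ P) (hQ : t ∈ Q) :
    (⊥ : Submodule (R ⧸ P ⊓ Q) (R ⧸ P ⊓ Q)).colon {Ideal.Quotient.mk (P ⊓ Q) t} =
      P.map (Ideal.Quotient.mk (P ⊓ Q)) := by
  ext s
  obtain ⟨s, rfl⟩ := Ideal.Quotient.mk_surjective s
  rw [Submodule.mem_colon_singleton, Submodule.mem_bot, smul_eq_mul, ← map_mul,
    Ideal.Quotient.eq_zero_iff_mem, Ideal.mem_quotient_iff_mem_sup, sup_of_le_left inf_le_left]
  exact ⟨fun h => (Ideal.IsPrime.mem_or_mem ‹_› h.1).resolve_right hP,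
    fun h => Ideal.mem_inf.mpr ⟨P.mul_mem_right _ h, Q.mul_mem_left _ hQ⟩⟩

/-- The associated primes of `R ⧸ P ⊓ Q`, for incomparable primes `P` and `Q`, are the images of
`P` and `Q`. -/
lemma associatedPrimes_quotient_inf {R : Type*} [CommRing R] (P Q : Ideal R)
    [hP : P.IsPrime] [hQ : Q.IsPrime] (hPQ : ¬ P ≤ Q) (hQP : ¬ Q ≤ P) :
    associatedPrimes (R ⧸ P ⊓ Q) (R ⧸ P ⊓ Q) =
      {P.map (Ideal.Quotient.mk (P ⊓ Q)), Q.map (Ideal.Quotient.mk (P ⊓ Q))} := by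
  have hPm : (P.map (Ideal.Quotient.mk (P ⊓ Q))).IsPrime :=
    Ideal.map_isPrime_of_surjective Ideal.Quotient.mk_surjective (by simp)
  have hQm : (Q.map (Ideal.Quotient.mk (P ⊓ Q))).IsPrime :=
    Ideal.map_isPrime_of_surjective Ideal.Quotient.mk_surjective (by simp)
  have colonP {t : R} (h₁ : t ∉ P) (h₂ : t ∈ Q) := Ideal.colon_bot_mk_inf h₁ h₂
  have colonQ {t : R} (h₁ : t ∉ Q) (h₂ : t ∈ P) :
      (⊥ : Submodule (R ⧸ P ⊓ Q) (R ⧸ P ⊓ Q)).colon {Ideal.Quotient.mk (P ⊓ Q) t} =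
        Q.map (Ideal.Quotient.mk (P ⊓ Q)) := by
    have := Ideal.colon_bot_mk_inf h₁ h₂
    rwa [inf_comm] at this
  obtain ⟨x, hxP, hxQ⟩ := Set.not_subset.mp hPQ
  obtain ⟨y, hyQ, hyP⟩ := Set.not_subset.mp hQP
  ext p
  rw [AssociatedPrimes.mem_iff, IsAssociatedPrime, Submodule.isAssociatedPrime_def,
    Set.mem_insert_iff, Set.mem_singleton_iff]
  constructor
  · rintro ⟨hp, t, rfl⟩
    obtain ⟨t, rfl⟩ := Ideal.Quotient.mk_surjective t
    by_cases h₁ : t ∈ P <;> by_cases h₂ : t ∈ Q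
    · refine absurd ?_ hp.ne_top
      rw [Ideal.Quotient.eq_zero_iff_mem.mpr (Ideal.mem_inf.mpr ⟨h₁, h₂⟩)]
      simp
    · rw [colonQ h₂ h₁, hQm.radical]
      exact .inr rfl
    · rw [colonP h₁ h₂, hPm.radical]
      exact .inl rfl
    · have key {s : R} (hs : Ideal.Quotient.mk (P ⊓ Q) s ∈
          ((⊥ : Submodule (R ⧸ P ⊓ Q) (R ⧸ P ⊓ Q)).colon
            {Ideal.Quotient.mk (P ⊓ Q) t}).radical) : s ∈ P ∧ s ∈ Q := by
        obtain ⟨n, hn⟩ := hs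
        rw [Submodule.mem_colon_singleton, Submodule.mem_bot, smul_eq_mul, ← map_pow, ← map_mul,
          Ideal.Quotient.eq_zero_iff_mem] at hn
        exact ⟨hP.mem_of_pow_mem _ ((hP.mem_or_mem hn.1).resolve_right h₁),
          hQ.mem_of_pow_mem _ ((hQ.mem_or_mem hn.2).resolve_right h₂)⟩
      have hxy : Ideal.Quotient.mk (P ⊓ Q) x * Ideal.Quotient.mk (P ⊓ Q) y = 0 := by
        rw [← map_mul, Ideal.Quotient.eq_zero_iff_mem]
        exact Ideal.mem_inf.mpr ⟨P.mul_mem_right _ hxP, Q.mul_mem_left _ hyQ⟩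
      rcases hp.mem_or_mem (hxy ▸ Ideal.zero_mem _) with h | h
      · exact absurd (key h).2 hxQ
      · exact absurd (key h).1 hyP
  · rintro (rfl | rfl)
    · exact ⟨hPm, _, by rw [colonP hyP hyQ, hPm.radical]⟩
    · exact ⟨hQm, _, by rw [colonQ hxQ hxP, hQm.radical]⟩

namespace MvPowerSeries

variable {σ τ K : Type*}

/-- Membership in an ideal generated by finitely many variables, in terms of coefficients. -/
lemma mem_span_X_image_iff [CommRing K] {S : Set σ} (hS : S.Finite) {f : MvPowerSeries σ K} :
    f ∈ Ideal.span ((X : σ → MvPowerSeries σ K) '' S) ↔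
      ∀ m : σ →₀ ℕ, (∀ i ∈ S, m i = 0) → coeff m f = 0 := by
  classical
  induction S, hS using Set.Finite.induction_on generalizing f with
  | empty =>
    simp only [Set.image_empty, Ideal.span_empty, Ideal.mem_bot, Set.mem_empty_iff_false,
      false_imp_iff, implies_true, true_imp_iff]
    exact MvPowerSeries.ext_iff
  | @insert i S _ _ ih =>
    rw [Set.image_insert_eq, Ideal.span_insert]
    constructor
    · intro hf m hm
      obtain ⟨g, hg, h, hh, rfl⟩ := Submodule.mem_sup.mp hf
      rw [map_add, X_dvd_iff.mp (Ideal.mem_span_singleton.mp hg) m (hm i (Set.mem_insert i S)),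
        ih.mp hh m fun j hj => hm j (Set.mem_insert_of_mem i hj), add_zero]
    · intro hf
      let g : MvPowerSeries σ K := fun m => if m i = 0 then coeff m f else 0
      have hg (m : σ →₀ ℕ) : coeff m g = if m i = 0 then coeff m f else 0 := rfl
      rw [← sub_add_cancel f g]
      refine Submodule.add_mem_sup (Ideal.mem_span_singleton.mpr (X_dvd_iff.mpr fun m hm => ?_))
        (ih.mpr fun m hm => ?_)
      · rw [map_sub, hg, if_pos hm, sub_self]
      · rw [hg]
        split_ifs with h
        · exact hf m (Set.forall_mem_insert.mpr ⟨h, hm⟩)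
        · rfl

lemma ker_killCompl [CommRing K] [Finite τ] (e : σ ↪ τ) :
    RingHom.ker (killCompl (R := K) e).toRingHom =
      Ideal.span ((X : τ → MvPowerSeries τ K) '' (Set.range e)ᶜ) := by
  ext f
  rw [mem_span_X_image_iff (Set.toFinite _), RingHom.mem_ker, MvPowerSeries.ext_iff]
  have key (m : τ →₀ ℕ) : (∀ i ∈ (Set.range e)ᶜ, m i = 0) ↔
      m ∈ Set.range (Finsupp.embDomain e) := by
    rw [Finsupp.mem_range_embDomain_iff]
    refine ⟨fun h i hi => ?_, fun h i hi => ?_⟩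
    · by_contra hi'
      exact Finsupp.mem_support_iff.mp hi (h i hi')
    · by_contra hi'
      exact hi (h (Finsupp.mem_support_iff.mpr hi'))
  simp only [key, Set.forall_mem_range]
  exact Iff.rfl

lemma killCompl_surjective [CommRing K] [Finite τ] (e : σ ↪ τ) :
    Function.Surjective (killCompl (R := K) e).toRingHom :=
  fun p => ⟨rename e p, killCompl_rename_app p⟩

/-- Setting the variables outside the range of `e` to zero identifies the quotient by the ideal
they generate with the power series ring in the remaining variables. -/
noncomputable def quotientSpanXEquiv [CommRing K] [Finite τ] (e : σ ↪ τ) :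
    (MvPowerSeries τ K ⧸ Ideal.span ((X : τ → MvPowerSeries τ K) '' (Set.range e)ᶜ)) ≃+*
      MvPowerSeries σ K :=
  (Ideal.quotEquivOfEq (ker_killCompl e).symm).trans
    (RingHom.quotientKerEquivOfSurjective (killCompl_surjective e))

lemma isPrime_span_X_image [CommRing K] [IsDomain K] [Finite σ] (S : Set σ) :
    (Ideal.span ((X : σ → MvPowerSeries σ K) '' S)).IsPrime := by
  have h := ker_killCompl (K := K) (Function.Embedding.subtype fun i => i ∉ S)
  rw [show (Set.range (Function.Embedding.subtype fun i => i ∉ S))ᶜ = S by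
    ext; simp] at h
  have : IsDomain (MvPowerSeries {i // i ∉ S} K) := NoZeroDivisors.to_isDomain _
  rw [← h]
  exact RingHom.ker_isPrime _

lemma X_mem_span_X_image_iff [CommRing K] [Nontrivial K] [Finite σ] {S : Set σ} {i : σ} :
    (X i : MvPowerSeries σ K) ∈ Ideal.span ((X : σ → MvPowerSeries σ K) '' S) ↔ i ∈ S := by
  classical
  refine ⟨fun h => ?_, fun h => Ideal.subset_span ⟨i, h, rfl⟩⟩
  by_contra hi
  have := (mem_span_X_image_iff (Set.toFinite S)).mp h (Finsupp.single i 1) fun j hj =>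
    Finsupp.single_eq_of_ne (by rintro rfl; exact hi hj)
  simp [coeff_X] at this

lemma span_X_image_inf_le [CommRing K] [Finite σ] (S T : Set σ) (i : σ) :
    Ideal.span ((X : σ → MvPowerSeries σ K) '' insert i S) ⊓
        Ideal.span ((X : σ → MvPowerSeries σ K) '' insert i T) ≤
      Ideal.span {X i} ⊔ (Ideal.span ((X : σ → MvPowerSeries σ K) '' S) ⊓
        Ideal.span ((X : σ → MvPowerSeries σ K) '' T)) := by
  classical
  rintro f ⟨hS, hT⟩
  replace hS := (mem_span_X_image_iff (Set.toFinite _)).mp hS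
  replace hT := (mem_span_X_image_iff (Set.toFinite _)).mp hT
  let g : MvPowerSeries σ K := fun m => if m i = 0 then coeff m f else 0
  have hg (m : σ →₀ ℕ) : coeff m g = if m i = 0 then coeff m f else 0 := rfl
  rw [← sub_add_cancel f g]
  refine Submodule.add_mem_sup (Ideal.mem_span_singleton.mpr (X_dvd_iff.mpr fun m hm => ?_))
    ⟨(mem_span_X_image_iff (Set.toFinite _)).mpr fun m hm => ?_,
      (mem_span_X_image_iff (Set.toFinite _)).mpr fun m hm => ?_⟩
  · rw [map_sub, hg, if_pos hm, sub_self]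
  · rw [hg]
    split_ifs with h
    · exact hS m (Set.forall_mem_insert.mpr ⟨h, hm⟩)
    · rfl
  · rw [hg]
    split_ifs with h
    · exact hT m (Set.forall_mem_insert.mpr ⟨h, hm⟩)
    · rfl

lemma X_mem_maximalIdeal [CommRing K] [IsLocalRing K] (i : σ) :
    (X i : MvPowerSeries σ K) ∈ maximalIdeal (MvPowerSeries σ K) := by
  rw [mem_maximalIdeal, mem_nonunits_iff, isUnit_iff_constantCoeff]
  simp

/-- The ring of formal power series in finitely many variables over a field has Krull dimension
the number of variables. -/
lemma ringKrullDim_eq_natCard [Field K] [Finite σ] :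
    ringKrullDim (MvPowerSeries σ K) = Nat.card σ := by
  induction σ using Finite.induction_empty_option with
  | of_equiv e ih =>
    rw [← Nat.card_congr e, ← ih]
    exact ringKrullDim_eq_of_ringEquiv (renameEquiv K e.symm).toRingEquiv
  | h_empty =>
    rw [ringKrullDim_eq_of_ringEquiv (isEmptyEquiv PEmpty K).toRingEquiv,
      ringKrullDim_eq_zero_of_field]
    simp
  | @h_option α _ ih =>
    have hX : (X none : MvPowerSeries (Option α) K) ∈ nonZeroDivisors _ := X_mem_nonzeroDivisors
    rw [← ringKrullDim_quotient_span_singleton_succ_eq_ringKrullDim_of_mem_nonZeroDivisors hX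
      (X_mem_maximalIdeal none)]
    have h := ringKrullDim_eq_of_ringEquiv (quotientSpanXEquiv (K := K)
      (Function.Embedding.some (α := α)))
    rw [show (Set.range (Function.Embedding.some (α := α)))ᶜ = {none} by
      ext x; cases x <;> simp, Set.image_singleton] at h
    rw [h, ih, Finite.card_option]
    norm_cast

/-- Two distinct variables outside `S ∪ T` form a weakly regular sequence modulo the intersection of
the ideals generated by the variables in `S` and in `T`. -/
lemma isWeaklyRegular_quotient_span_X_inf [CommRing K] [IsDomain K] [Finite σ] {S T : Set σ}
    {i j : σ} (hiS : i ∉ S) (hiT : i ∉ T) (hjS : j ∉ S) (hjT : j ∉ T) (hij : j ≠ i)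
    {I : Ideal (MvPowerSeries σ K)}
    (hI : I = Ideal.span ((X : σ → MvPowerSeries σ K) '' S) ⊓
      Ideal.span ((X : σ → MvPowerSeries σ K) '' T)) :
    RingTheory.Sequence.IsWeaklyRegular (MvPowerSeries σ K ⧸ I)
      [Ideal.Quotient.mk I (X i), Ideal.Quotient.mk I (X j)] := by
  have regular_mod {U : Set σ} {k : σ} (hk : k ∉ U) {f : MvPowerSeries σ K}
      (hf : X k * f ∈ Ideal.span ((X : σ → MvPowerSeries σ K) '' U)) :
      f ∈ Ideal.span ((X : σ → MvPowerSeries σ K) '' U) :=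
    ((isPrime_span_X_image U).mem_or_mem hf).resolve_left (mt X_mem_span_X_image_iff.mp hk)
  have span_le (U : Set σ) : Ideal.span ((X : σ → MvPowerSeries σ K) '' U) ≤
      Ideal.span ((X : σ → MvPowerSeries σ K) '' insert i U) :=
    Ideal.span_mono (Set.image_mono (Set.subset_insert i U))
  have X_mem (U : Set σ) : Ideal.span {(X i : MvPowerSeries σ K)} ≤
      Ideal.span ((X : σ → MvPowerSeries σ K) '' insert i U) :=
    Ideal.span_mono (Set.singleton_subset_iff.mpr ⟨i, Set.mem_insert i U, rfl⟩)
  rw [RingTheory.Sequence.isWeaklyRegular_iff_Fin]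
  intro n
  rw [isSMulRegular_quotient_iff_mem_of_smul_mem]
  intro f
  obtain ⟨f, rfl⟩ := Ideal.Quotient.mk_surjective f
  fin_cases n
  · simp only [List.length_cons, List.length_nil, Nat.reduceAdd, Fin.zero_eta, Fin.getElem_fin,
      Fin.val_zero, List.getElem_cons_zero, List.take_zero, Ideal.ofList_nil, smul_eq_mul,
      Ideal.mul_top, ← map_mul]
    rw [Ideal.mem_bot, Ideal.mem_bot, Ideal.Quotient.eq_zero_iff_mem,
      Ideal.Quotient.eq_zero_iff_mem, hI]
    exact fun hf => Ideal.mem_inf.mpr ⟨regular_mod hiS hf.1, regular_mod hiT hf.2⟩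
  · simp only [List.length_cons, List.length_nil, Nat.reduceAdd, Fin.mk_one, Fin.getElem_fin,
      Fin.val_one, List.getElem_cons_succ, List.getElem_cons_zero, List.take_succ_cons,
      List.take_zero, Ideal.ofList_singleton, smul_eq_mul, Ideal.mul_top, ← map_mul]
    rw [← Set.image_singleton, ← Ideal.map_span, Ideal.mem_quotient_iff_mem_sup,
      Ideal.mem_quotient_iff_mem_sup, hI]
    intro hf
    have hle (U : Set σ) (hU : Ideal.span ((X : σ → MvPowerSeries σ K) '' S) ⊓
        Ideal.span ((X : σ → MvPowerSeries σ K) '' T) ≤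
          Ideal.span ((X : σ → MvPowerSeries σ K) '' U)) (hj : j ∉ U) :
        f ∈ Ideal.span ((X : σ → MvPowerSeries σ K) '' insert i U) :=
      regular_mod (by simp [hij, hj]) (sup_le (X_mem U) (hU.trans (span_le U)) hf)
    exact span_X_image_inf_le S T i
      (Ideal.mem_inf.mpr ⟨hle S inf_le_left hjS, hle T inf_le_right hjT⟩)

/-- The quotient of a power series ring over a field by the ideal generated by the variables outside
the range of `e` has dimension the number of remaining variables. -/
lemma ringKrullDim_quotient_span_X [Field K] [Finite σ] [Finite τ] (e : τ ↪ σ) :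
    ringKrullDim (MvPowerSeries σ K ⧸
      Ideal.span ((X : σ → MvPowerSeries σ K) '' (Set.range e)ᶜ)) = Nat.card τ :=
  (ringKrullDim_eq_of_ringEquiv (quotientSpanXEquiv e)).trans ringKrullDim_eq_natCard

end MvPowerSeries

/-- Let `T = K⟦x, y₁, …, y_a, z₁, …, z_b⟧/((x) ∩ (y₁, …, y_a))` with `K` a field and
`a, b > 1`.  Then the associated primes of `T` are exactly the images of `(x)` and
`(y₁, …, y_a)`, `dim T = a + b`, `dim (T/(y₁, …, y_a)) = b + 1 < a + b`, and
`depth T > 1`. -/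
theorem stmt18 (K : Type) [Field K] (a b : ℕ) (ha : 1 < a) (hb : 1 < b) :
    associatedPrimes (exRing K a b) (exRing K a b) =
      {Ideal.map (Ideal.Quotient.mk (exIdeal K a b))
          (Ideal.span {MvPowerSeries.X (Sum.inl ())}),
        Ideal.map (Ideal.Quotient.mk (exIdeal K a b))
          (Ideal.span (Set.range fun i : Fin a =>
            MvPowerSeries.X (Sum.inr (Sum.inl i))))} ∧
    ringKrullDim (exRing K a b) = ((a + b : ℕ) : WithBot ℕ∞) ∧
    ringKrullDim (exRing K a b ⧸ Ideal.map (Ideal.Quotient.mk (exIdeal K a b))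
        (Ideal.span (Set.range fun i : Fin a => MvPowerSeries.X (Sum.inr (Sum.inl i)))))
      = ((b + 1 : ℕ) : WithBot ℕ∞) ∧
    ((b + 1 : ℕ) : WithBot ℕ∞) < ((a + b : ℕ) : WithBot ℕ∞) ∧
    ∃ h : IsLocalRing (exRing K a b), 1 < @ringDepth (exRing K a b) _ h := by
  have hx : Ideal.span {(MvPowerSeries.X (Sum.inl ()) : MvPowerSeries (Var a b) K)} =
      Ideal.span (MvPowerSeries.X '' {Sum.inl ()}) := by rw [Set.image_singleton]
  have hy : Ideal.span (Set.range fun i : Fin a =>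
      (MvPowerSeries.X (Sum.inr (Sum.inl i)) : MvPowerSeries (Var a b) K)) =
      Ideal.span (MvPowerSeries.X '' Set.range fun i : Fin a => Sum.inr (Sum.inl i)) := by
    rw [← Set.range_comp]; rfl
  have hxdim := MvPowerSeries.ringKrullDim_quotient_span_X (K := K)
    (Function.Embedding.inr : Fin a ⊕ Fin b ↪ Var a b)
  rw [show (Set.range (Function.Embedding.inr : Fin a ⊕ Fin b ↪ Var a b))ᶜ = {Sum.inl ()} by
    ext (_ | _) <;> simp, ← hx] at hxdim
  have hydim := MvPowerSeries.ringKrullDim_quotient_span_X (K := K)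
    ((Function.Embedding.refl Unit).sumMap Function.Embedding.inr : Unit ⊕ Fin b ↪ Var a b)
  rw [show (Set.range ((Function.Embedding.refl Unit).sumMap Function.Embedding.inr :
      Unit ⊕ Fin b ↪ Var a b))ᶜ = Set.range fun i : Fin a => Sum.inr (Sum.inl i) by
    ext (_ | _ | _) <;> simp, ← hy] at hydim
  have hxprime : (Ideal.span {(MvPowerSeries.X (Sum.inl ()) :
      MvPowerSeries (Var a b) K)}).IsPrime := hx ▸ MvPowerSeries.isPrime_span_X_image _
  have hyprime : (Ideal.span (Set.range fun i : Fin a =>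
      (MvPowerSeries.X (Sum.inr (Sum.inl i)) : MvPowerSeries (Var a b) K))).IsPrime :=
    hy ▸ MvPowerSeries.isPrime_span_X_image _
  have hI : exIdeal K a b = Ideal.span (MvPowerSeries.X '' {Sum.inl ()}) ⊓
      Ideal.span (MvPowerSeries.X '' Set.range fun i : Fin a => Sum.inr (Sum.inl i)) := by
    rw [exIdeal, hx, hy]
  have : Nontrivial (exRing K a b) :=
    Ideal.Quotient.nontrivial_iff.mpr (ne_top_of_le_ne_top hxprime.ne_top inf_le_left)
  refine ⟨associatedPrimes_quotient_inf _ _ ?_ ?_, le_antisymm ?_ ?_, ?_, ?_, ?_⟩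
  · rw [hx, hy]
    intro h
    have := MvPowerSeries.X_mem_span_X_image_iff.mp
      (h (MvPowerSeries.X_mem_span_X_image_iff.mpr (Set.mem_singleton _)))
    simp at this
  · rw [hx, hy]
    intro h
    have := MvPowerSeries.X_mem_span_X_image_iff.mp
      (h (MvPowerSeries.X_mem_span_X_image_iff.mpr ⟨⟨0, by omega⟩, rfl⟩))
    simp at this
  · have hmem : (MvPowerSeries.X (Sum.inl ()) * MvPowerSeries.X (Sum.inr (Sum.inl ⟨0, by omega⟩)) :
        MvPowerSeries (Var a b) K) ∈ exIdeal K a b :=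
      Ideal.mem_inf.mpr ⟨Ideal.mul_mem_right _ _ (Ideal.mem_span_singleton_self _),
        Ideal.mul_mem_left _ _ (Ideal.subset_span ⟨_, rfl⟩)⟩
    have hle := ringKrullDim_succ_le_of_surjective (Ideal.Quotient.mk (exIdeal K a b))
      Ideal.Quotient.mk_surjective (mul_mem MvPowerSeries.X_mem_nonzeroDivisors
        MvPowerSeries.X_mem_nonzeroDivisors) (Ideal.Quotient.eq_zero_iff_mem.mpr hmem)
    rw [MvPowerSeries.ringKrullDim_eq_natCard] at hle
    have hcard : Nat.card (Var a b) = (a + b) + 1 := by simp; ring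
    rw [hcard, Nat.cast_succ] at hle
    exact ENat.WithBot.add_le_add_one_right_iff.mp hle
  · have hle := ringKrullDim_le_of_surjective
      (Ideal.Quotient.factor (S := exIdeal K a b) (T := Ideal.span {MvPowerSeries.X (Sum.inl ())})
        inf_le_left) (Ideal.Quotient.factor_surjective _)
    rw [hxdim] at hle
    simpa using hle
  · refine (ringKrullDim_eq_of_ringEquiv
      (DoubleQuot.quotQuotEquivQuotOfLE inf_le_right)).trans (hydim.trans ?_)
    simp [add_comm]
  · norm_cast
    omega
  · have hloc : IsLocalRing (exRing K a b) :=
      IsLocalRing.of_surjective' (Ideal.Quotient.mk (exIdeal K a b)) Ideal.Quotient.mk_surjective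
    have hhom : IsLocalHom (Ideal.Quotient.mk (exIdeal K a b)) :=
      IsLocalHom.of_surjective _ Ideal.Quotient.mk_surjective
    have hmax (v : Var a b) :
        Ideal.Quotient.mk (exIdeal K a b) (MvPowerSeries.X v) ∈ maximalIdeal (exRing K a b) :=
      (map_mem_nonunits_iff _ _).mpr (MvPowerSeries.X_mem_maximalIdeal v)
    refine ⟨hloc, lt_of_lt_of_le (by norm_num : (1 : ℕ∞) < 2) (le_sSup
      ⟨[Ideal.Quotient.mk _ (MvPowerSeries.X (Sum.inr (Sum.inr ⟨0, by omega⟩))),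
        Ideal.Quotient.mk _ (MvPowerSeries.X (Sum.inr (Sum.inr ⟨1, by omega⟩)))],
        by simp, List.forall_mem_cons.mpr ⟨hmax _, List.forall_mem_singleton.mpr (hmax _)⟩, ?_⟩)⟩
    rw [isRegular_iff_isWeaklyRegular_of_subset_maximalIdeal
      (List.forall_mem_cons.mpr ⟨hmax _, List.forall_mem_singleton.mpr (hmax _)⟩)]
    exact MvPowerSeries.isWeaklyRegular_quotient_span_X_inf (by simp) (by simp) (by simp) (by simp)
      (by simp) hI
end
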